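/- arXiv:2506.19346 — 7 statements merged into one kernel-verified Lean document; each statement's English description precedes it below -/
import Mathlib

section
/- Suppose 3 ≤ k ≤ q. Then any k−1 columns of the matrix G_1 are linearly independent over F_q; in particular, every nonzero codeword of the dual code RL_k^⊥(F_q^*, M) has Hamming weight at least k. -/
open Polynomial in
theorem rl_key (q k : ℕ) (F : Type*) [Field F] [DecidableEq F]
    (hk3 : 3 ≤ k) (hkq : k ≤ q)
    (β : Fin (q - 1) → F) (hβinj : Function.Injective β)
    (a : Matrix (Fin 2) (Fin 2) F) (ha : IsUnit a.det)
    (G₁ : Matrix (Fin k) (Fin (q + 1)) F)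
    (hGv : ∀ (i : Fin k) (j : Fin (q + 1)) (h : (j : ℕ) < q - 1),
      G₁ i j = β ⟨j, h⟩ ^ (i : ℕ))
    (hGc1 : ∀ (i : Fin k) (j : Fin (q + 1)), (j : ℕ) = q - 1 →
      G₁ i j = if (i : ℕ) = k - 2 then a 0 0 else if (i : ℕ) = k - 1 then a 1 0 else 0)
    (hGc2 : ∀ (i : Fin k) (j : Fin (q + 1)), (j : ℕ) = q →
      G₁ i j = if (i : ℕ) = k - 2 then a 0 1 else if (i : ℕ) = k - 1 then a 1 1 else 0)
    (c : Fin (q + 1) → F) (hc : ∀ i, ∑ j, c j * G₁ i j = 0)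
    (hw : hammingNorm c < k) : c = 0 := by
  have hV : ∀ j₀ : Fin (q + 1), (j₀ : ℕ) < q - 1 → c j₀ = 0 := by
    intro j₀ hj₀
    by_contra hne
    let b : Fin (q + 1) → F := fun j => if h : (j : ℕ) < q - 1 then β ⟨j, h⟩ else 0
    let S : Finset (Fin (q + 1)) := Finset.univ.filter (fun j => c j ≠ 0)
    have hS : S.card < k := hw
    let T : Finset (Fin (q + 1)) := S.filter (fun j => (j : ℕ) < q - 1 ∧ j ≠ j₀)
    have hj₀T : j₀ ∉ T := by simp [T]
    have hT1 : T.card + 1 ≤ S.card := by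
      rw [← Finset.card_insert_of_notMem hj₀T]
      apply Finset.card_le_card
      intro x hx
      rcases Finset.mem_insert.1 hx with rfl | hx
      · simp [S, hne]
      · exact (Finset.mem_filter.1 hx).1
    let P : F[X] := ∏ j ∈ T, (X - C (b j))
    have hdeg : P.natDegree = T.card := natDegree_finsetProd_X_sub_C_eq_card T b
    have hPk : P.natDegree < k := by omega
    have key : ∑ j, c j * ∑ i : Fin k, P.coeff i * G₁ i j = 0 := by
      simp_rw [Finset.mul_sum]
      rw [Finset.sum_comm]
      apply Finset.sum_eq_zero
      intro i _
      have := hc i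
      calc _ = P.coeff i * ∑ j, c j * G₁ i j := by
            rw [Finset.mul_sum]; exact Finset.sum_congr rfl (fun j _ => by ring)
        _ = 0 := by rw [this, mul_zero]
    have hev : ∀ j : Fin (q + 1), (j : ℕ) < q - 1 →
        ∑ i : Fin k, P.coeff i * G₁ i j = P.eval (b j) := by
      intro j hj
      rw [eval_eq_sum_range' hPk, ← Fin.sum_univ_eq_sum_range (fun i => P.coeff i * b j ^ i)]
      apply Finset.sum_congr rfl
      intro i _
      rw [hGv i j hj]
      simp [b, hj]
    rw [Finset.sum_eq_single j₀] at key
    · rw [hev j₀ hj₀] at key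
      rcases mul_eq_zero.1 key with h | h
      · exact hne h
      · simp only [P, eval_prod, Finset.prod_eq_zero_iff] at h
        obtain ⟨j, hjT, hj⟩ := h
        have hj' := (Finset.mem_filter.1 hjT).2
        simp only [eval_sub, eval_X, eval_C, sub_eq_zero, b, hj₀, hj'.1, dif_pos] at hj
        have := hβinj hj
        apply hj'.2
        simp only [Fin.mk.injEq] at this
        exact Fin.ext this.symm
    · intro j _ hjj
      by_cases hcj : c j = 0
      · simp [hcj]
      by_cases hj : (j : ℕ) < q - 1
      · rw [hev j hj]
        have : j ∈ T := by simp [T, S, hcj, hj, hjj]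
        have h0 : P.eval (b j) = 0 := by
          simp only [P, eval_prod]
          exact Finset.prod_eq_zero this (by simp)
        rw [h0, mul_zero]
      · have hjT : j ∉ insert j₀ T := by simp [T, hj, hjj]
        have hT2 : T.card + 2 ≤ S.card := by
          have : (insert j (insert j₀ T)).card ≤ S.card := by
            apply Finset.card_le_card
            intro x hx
            rcases Finset.mem_insert.1 hx with rfl | hx
            · simp [S, hcj]
            rcases Finset.mem_insert.1 hx with rfl | hx
            · simp [S, hne]
            · exact (Finset.mem_filter.1 hx).1
          rw [Finset.card_insert_of_notMem hjT, Finset.card_insert_of_notMem hj₀T] at this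
          omega
        rw [Finset.sum_eq_zero, mul_zero]
        intro i _
        by_cases hi : (i : ℕ) < k - 2
        · have : G₁ i j = 0 := by
            have h1 : (i : ℕ) ≠ k - 2 := by omega
            have h2 : (i : ℕ) ≠ k - 1 := by omega
            have h3 : (j : ℕ) = q - 1 ∨ (j : ℕ) = q := by omega
            rcases h3 with h3 | h3
            · rw [hGc1 i j h3, if_neg h1, if_neg h2]
            · rw [hGc2 i j h3, if_neg h1, if_neg h2]
          rw [this, mul_zero]
        · rw [coeff_eq_zero_of_natDegree_lt (by omega), zero_mul]
    · simp
  let u : Fin (q + 1) := ⟨q - 1, by omega⟩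
  let v : Fin (q + 1) := ⟨q, by omega⟩
  have huv : u ≠ v := by
    intro h
    have := congrArg Fin.val h
    simp only [u, v] at this
    omega
  have hsum : ∀ i, c u * G₁ i u + c v * G₁ i v = 0 := by
    intro i
    rw [← hc i, ← Finset.sum_pair (f := fun j => c j * G₁ i j) huv]
    apply Finset.sum_subset (Finset.subset_univ _)
    intro j _ hj
    have : (j : ℕ) < q - 1 := by
      simp only [Finset.mem_insert, Finset.mem_singleton, not_or, Fin.ext_iff, u, v] at hj
      omega
    rw [hV j this, zero_mul]
  have e1 := hsum ⟨k - 2, by omega⟩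
  have e2 := hsum ⟨k - 1, by omega⟩
  have hk : k - 1 ≠ k - 2 := by omega
  rw [hGc1 _ u rfl, hGc2 _ v rfl] at e1 e2
  simp only [if_true, if_neg hk] at e1 e2
  have hd : a 0 0 * a 1 1 - a 0 1 * a 1 0 ≠ 0 := by
    rw [← Matrix.det_fin_two]; exact ha.ne_zero
  have hu : c u = 0 := by
    have : c u * (a 0 0 * a 1 1 - a 0 1 * a 1 0) = 0 := by
      linear_combination a 1 1 * e1 - a 0 1 * e2
    exact (mul_eq_zero.1 this).resolve_right hd
  have hv : c v = 0 := by
    have : c v * (a 0 0 * a 1 1 - a 0 1 * a 1 0) = 0 := by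
      linear_combination a 0 0 * e2 - a 1 0 * e1
    exact (mul_eq_zero.1 this).resolve_right hd
  funext j
  by_cases hj : (j : ℕ) < q - 1
  · exact hV j hj
  · have h3 : j = u ∨ j = v := by
      simp only [Fin.ext_iff, u, v]
      omega
    rcases h3 with rfl | rfl
    · exact hu
    · exact hv

/-- For `3 ≤ k ≤ q`, any `k-1` columns of the matrix `G₁` are linearly
independent over `F_q`; in particular, every nonzero codeword of the dual code
`RL_k^⊥(F_q^*, M)` has Hamming weight at least `k`. -/
theorem stmt0 (p m q k : ℕ) (hp : p.Prime) (hm : 0 < m) (hq : q = p ^ m)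
    (F : Type*) [Field F] [Fintype F] [DecidableEq F] (hF : Fintype.card F = q)
    (hk3 : 3 ≤ k) (hkq : k ≤ q)
    (β : Fin (q - 1) → F) (hβinj : Function.Injective β)
    (hβrange : Set.range β = {x : F | x ≠ 0})
    (a : Matrix (Fin 2) (Fin 2) F) (ha : IsUnit a.det)
    (G₁ : Matrix (Fin k) (Fin (q + 1)) F)
    (hGv : ∀ (i : Fin k) (j : Fin (q + 1)) (h : (j : ℕ) < q - 1),
      G₁ i j = β ⟨j, h⟩ ^ (i : ℕ))
    (hGc1 : ∀ (i : Fin k) (j : Fin (q + 1)), (j : ℕ) = q - 1 →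
      G₁ i j = if (i : ℕ) = k - 2 then a 0 0 else if (i : ℕ) = k - 1 then a 1 0 else 0)
    (hGc2 : ∀ (i : Fin k) (j : Fin (q + 1)), (j : ℕ) = q →
      G₁ i j = if (i : ℕ) = k - 2 then a 0 1 else if (i : ℕ) = k - 1 then a 1 1 else 0) :
    (∀ s : Finset (Fin (q + 1)), s.card = k - 1 →
      LinearIndependent F (fun j : s => fun i : Fin k => G₁ i j)) ∧
    (∀ c : Fin (q + 1) → F,
      (∀ y : Fin (q + 1) → F, (∃ x : Fin k → F, y = Matrix.vecMul x G₁) →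
        ∑ i, c i * y i = 0) →
      c ≠ 0 → k ≤ hammingNorm c) := by
  have key := rl_key q k F hk3 hkq β hβinj a ha G₁ hGv hGc1 hGc2
  constructor
  · intro s hs
    rw [Fintype.linearIndependent_iff]
    intro g hg
    let c : Fin (q + 1) → F := fun j => if h : j ∈ s then g ⟨j, h⟩ else 0
    have hc0 : c = 0 := by
      apply key c
      · intro i
        have h1 := congrFun hg i
        simp only [Finset.sum_apply, Pi.smul_apply, smul_eq_mul, Pi.zero_apply] at h1
        rw [← h1, ← Finset.sum_subset (Finset.subset_univ s), ← Finset.sum_coe_sort s]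
        · apply Finset.sum_congr rfl
          intro j _
          simp [c]
        · intro j _ hj
          simp [c, hj]
      · have : hammingNorm c ≤ s.card := by
          apply Finset.card_le_card
          intro j hj
          by_contra hjs
          simp [c, hjs] at hj
        omega
    intro j
    have := congrFun hc0 j
    simpa [c] using this
  · intro c hc hne
    by_contra hlt
    apply hne
    apply key c _ (by omega)
    intro i
    exact hc (fun j => G₁ i j) ⟨Pi.single i 1, by rw [Matrix.single_one_vecMul]; rfl⟩
end

section
/- Suppose 3 ≤ k ≤ q. Then there is no codeword c = (c_1, …, c_{q+1}) of Hamming weight exactly k in the dual code RL_k^⊥(F_q^*, M) satisfying c_q = 0 and c_{q+1} = 0 (i.e., no weight-k dual codeword whose support is contained in the first q−1 coordinates). -/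
/-- no weight-k dual codeword with the last two coordinates both zero. -/
theorem stmt1 (p m q k : ℕ) (hp : p.Prime) (hm : 0 < m) (hq : q = p ^ m)
    (F : Type*) [Field F] [Fintype F] [DecidableEq F] (hF : Fintype.card F = q)
    (hk3 : 3 ≤ k) (hkq : k ≤ q)
    (β : Fin (q - 1) → F) (hβinj : Function.Injective β)
    (hβrange : Set.range β = {x : F | x ≠ 0})
    (a : Matrix (Fin 2) (Fin 2) F) (ha : IsUnit a.det)
    (G₁ : Matrix (Fin k) (Fin (q + 1)) F)
    (hGv : ∀ (i : Fin k) (j : Fin (q + 1)) (h : (j : ℕ) < q - 1),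
      G₁ i j = β ⟨j, h⟩ ^ (i : ℕ))
    (hGc1 : ∀ (i : Fin k) (j : Fin (q + 1)), (j : ℕ) = q - 1 →
      G₁ i j = if (i : ℕ) = k - 2 then a 0 0 else if (i : ℕ) = k - 1 then a 1 0 else 0)
    (hGc2 : ∀ (i : Fin k) (j : Fin (q + 1)), (j : ℕ) = q →
      G₁ i j = if (i : ℕ) = k - 2 then a 0 1 else if (i : ℕ) = k - 1 then a 1 1 else 0) :
    ¬ ∃ c : Fin (q + 1) → F,
      (∀ y : Fin (q + 1) → F, (∃ x : Fin k → F, y = Matrix.vecMul x G₁) →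
        ∑ i, c i * y i = 0) ∧
      hammingNorm c = k ∧
      c ⟨q - 1, by omega⟩ = 0 ∧ c ⟨q, by omega⟩ = 0 := by
  rintro ⟨c, hdual, hw, hc1, hc2⟩
  have hlt : ∀ j : Fin (q + 1), c j ≠ 0 → (j : ℕ) < q - 1 := by
    intro j hj
    by_contra h
    have hj2 := j.isLt
    have : (j : ℕ) = q - 1 ∨ (j : ℕ) = q := by omega
    rcases this with h1 | h1
    · apply hj
      rw [← hc1]
      congr 1
      exact Fin.ext h1
    · apply hj
      rw [← hc2]
      congr 1
      exact Fin.ext h1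
  have hrow : ∀ i : Fin k, ∑ j, c j * G₁ i j = 0 := by
    intro i
    exact hdual (fun j => G₁ i j) ⟨Pi.single i 1, by
      rw [Matrix.single_one_vecMul]; rfl⟩
  have hcard : Fintype.card {j : Fin (q + 1) // c j ≠ 0} = k := by
    rw [← hw, Fintype.card_subtype]; rfl
  let e := (Fintype.equivFinOfCardEq hcard).symm
  have hz : (fun l : Fin k => c (e l).1) = 0 := by
    apply Matrix.eq_zero_of_forall_pow_sum_mul_pow_eq_zero
      (f := fun l : Fin k => β ⟨(e l).1, hlt _ (e l).2⟩)
    · intro l l' h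
      have h2 := hβinj h
      apply e.injective
      apply Subtype.ext
      apply Fin.ext
      simpa using h2
    · intro i
      have h1 := hrow i
      have h2 : ∑ j : {j : Fin (q + 1) // c j ≠ 0}, c j.1 * G₁ i j.1 = 0 := by
        refine Eq.trans ?_ h1
        rw [← Finset.sum_subtype (Finset.univ.filter fun j => c j ≠ 0) (by simp)
          (fun j => c j * G₁ i j)]
        apply Finset.sum_subset (Finset.subset_univ _)
        intro j _ hj
        have : c j = 0 := by simpa using hj
        rw [this, zero_mul]
      refine Eq.trans ?_ h2
      rw [← e.sum_comp]
      apply Finset.sum_congr rfl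
      intro l _
      rw [hGv i (e l).1 (hlt _ (e l).2)]
  have h0 := congrFun hz ⟨0, by omega⟩
  exact (e ⟨0, by omega⟩).2 h0
end

section
/- Suppose 3 ≤ k ≤ q. Then there is no codeword c = (c_1, …, c_{q+1}) of Hamming weight exactly k in the dual code RL_k^⊥(F_q^*, M) satisfying both c_q ≠ 0 and c_{q+1} ≠ 0. -/
/-- no weight-k dual codeword with the last two coordinates both nonzero. -/
theorem stmt2 (p m q k : ℕ) (hp : p.Prime) (hm : 0 < m) (hq : q = p ^ m)
    (F : Type*) [Field F] [Fintype F] [DecidableEq F] (hF : Fintype.card F = q)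
    (hk3 : 3 ≤ k) (hkq : k ≤ q)
    (β : Fin (q - 1) → F) (hβinj : Function.Injective β)
    (hβrange : Set.range β = {x : F | x ≠ 0})
    (a : Matrix (Fin 2) (Fin 2) F) (ha : IsUnit a.det)
    (G₁ : Matrix (Fin k) (Fin (q + 1)) F)
    (hGv : ∀ (i : Fin k) (j : Fin (q + 1)) (h : (j : ℕ) < q - 1),
      G₁ i j = β ⟨j, h⟩ ^ (i : ℕ))
    (hGc1 : ∀ (i : Fin k) (j : Fin (q + 1)), (j : ℕ) = q - 1 →
      G₁ i j = if (i : ℕ) = k - 2 then a 0 0 else if (i : ℕ) = k - 1 then a 1 0 else 0)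
    (hGc2 : ∀ (i : Fin k) (j : Fin (q + 1)), (j : ℕ) = q →
      G₁ i j = if (i : ℕ) = k - 2 then a 0 1 else if (i : ℕ) = k - 1 then a 1 1 else 0) :
    ¬ ∃ c : Fin (q + 1) → F,
      (∀ y : Fin (q + 1) → F, (∃ x : Fin k → F, y = Matrix.vecMul x G₁) →
        ∑ i, c i * y i = 0) ∧
      hammingNorm c = k ∧
      c ⟨q - 1, by omega⟩ ≠ 0 ∧ c ⟨q, by omega⟩ ≠ 0 := by
  rintro ⟨c, hc, hw, h1, h2⟩
  classical
  set e1 : Fin (q + 1) := ⟨q - 1, by omega⟩ with he1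
  set e2 : Fin (q + 1) := ⟨q, by omega⟩ with he2
  have hne : e1 ≠ e2 := by
    intro h
    have := congrArg Fin.val h
    simp [he1, he2] at this
    omega
  set S : Finset (Fin (q + 1)) := Finset.univ.filter (fun i => c i ≠ 0) with hS
  have hScard : S.card = k := hw
  set T := (S.erase e1).erase e2 with hT
  have hTcard : T.card = k - 2 := by
    rw [hT, Finset.card_erase_of_mem, Finset.card_erase_of_mem, hScard]
    · omega
    · simp [hS, h1]
    · simp [hS, h2, hne.symm]
  have hlt : ∀ j : Fin (q + 1), j ≠ e1 → j ≠ e2 → (j : ℕ) < q - 1 := by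
    intro j a1 a2
    have b1 : (j : ℕ) ≠ q - 1 := fun h => a1 (Fin.ext h)
    have b2 : (j : ℕ) ≠ q := fun h => a2 (Fin.ext h)
    have := j.2
    omega
  obtain ⟨j0, hj0⟩ : T.Nonempty := by
    rw [← Finset.card_pos]; omega
  let b : Fin (q + 1) → F := fun j => if h : (j : ℕ) < q - 1 then β ⟨j, h⟩ else 0
  let P : Polynomial F := ∏ j ∈ T.erase j0, (Polynomial.X - Polynomial.C (b j))
  have hdeg : P.natDegree = k - 3 := by
    simp only [P]
    rw [Polynomial.natDegree_finsetProd_X_sub_C_eq_card, Finset.card_erase_of_mem hj0, hTcard]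
    omega
  have hsum := hc _ ⟨fun i => P.coeff i, rfl⟩
  have hy : ∀ j : Fin (q + 1), j ≠ e1 → j ≠ e2 →
      Matrix.vecMul (fun i : Fin k => P.coeff i) G₁ j = P.eval (b j) := by
    intro j a1 a2
    have hj := hlt j a1 a2
    rw [Polynomial.eval_eq_sum_range' (n := k) (by omega)]
    rw [Finset.sum_range]
    simp only [Matrix.vecMul, dotProduct]
    refine Finset.sum_congr rfl fun i _ => ?_
    rw [hGv i j hj]
    simp [b, hj]
  have hco : ∀ i : ℕ, k - 3 < i → P.coeff i = 0 := fun i hi =>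
    Polynomial.coeff_eq_zero_of_natDegree_lt (by omega)
  have hy1 : Matrix.vecMul (fun i : Fin k => P.coeff i) G₁ e1 = 0 := by
    simp only [Matrix.vecMul, dotProduct]
    refine Finset.sum_eq_zero fun i _ => ?_
    rw [hGc1 i e1 rfl]
    by_cases h : k - 3 < (i : ℕ)
    · rw [hco _ h, zero_mul]
    · rw [if_neg (by omega), if_neg (by omega), mul_zero]
  have hy2 : Matrix.vecMul (fun i : Fin k => P.coeff i) G₁ e2 = 0 := by
    simp only [Matrix.vecMul, dotProduct]
    refine Finset.sum_eq_zero fun i _ => ?_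
    rw [hGc2 i e2 rfl]
    by_cases h : k - 3 < (i : ℕ)
    · rw [hco _ h, zero_mul]
    · rw [if_neg (by omega), if_neg (by omega), mul_zero]
  have hj0' : j0 ≠ e2 ∧ j0 ≠ e1 ∧ c j0 ≠ 0 := by
    simpa [hT, hS] using hj0
  rw [Finset.sum_eq_single j0] at hsum
  · rw [hy j0 hj0'.2.1 hj0'.1] at hsum
    rcases mul_eq_zero.1 hsum with h | h
    · exact hj0'.2.2 h
    · simp only [P] at h
      rw [Polynomial.eval_prod, Finset.prod_eq_zero_iff] at h
      obtain ⟨j, hj, hjz⟩ := h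
      have hj' : j ≠ j0 ∧ j ≠ e2 ∧ j ≠ e1 ∧ c j ≠ 0 := by
        simpa [hT, hS] using hj
      have l1 := hlt j hj'.2.2.1 hj'.2.1
      have l0 := hlt j0 hj0'.2.1 hj0'.1
      simp only [Polynomial.eval_sub, Polynomial.eval_X, Polynomial.eval_C, b, l1, l0,
        dif_pos, sub_eq_zero] at hjz
      have := congrArg Fin.val (hβinj hjz)
      exact hj'.1 (Fin.ext this.symm)
  · intro j _ hj
    by_cases a1 : j = e1
    · rw [a1, hy1, mul_zero]
    by_cases a2 : j = e2
    · rw [a2, hy2, mul_zero]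
    by_cases a3 : c j = 0
    · rw [a3, zero_mul]
    rw [hy j a1 a2]
    have hm' : j ∈ T.erase j0 := by simp [hT, hS, hj, a1, a2, a3]
    have : P.eval (b j) = 0 := by
      simp only [P]
      rw [Polynomial.eval_prod]
      exact Finset.prod_eq_zero hm' (by simp)
    rw [this, mul_zero]
  · intro h
    exact absurd (Finset.mem_univ _) h
end

section
/- Suppose 3 ≤ k ≤ q. If a_{11} = 0, then there is no codeword c = (c_1, …, c_{q+1}) of Hamming weight exactly k in the dual code RL_k^⊥(F_q^*, M) with c_q ≠ 0 and c_{q+1} = 0. Likewise, if a_{12} = 0, then there is no codeword c of Hamming weight exactly k in RL_k^⊥(F_q^*, M) with c_q = 0 and c_{q+1} ≠ 0. -/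
open Polynomial in
theorem aux_no_codeword {F ι : Type*} [Field F] [DecidableEq F] [Fintype ι] [DecidableEq ι]
    (k : ℕ) (hk : 3 ≤ k) (G : Matrix (Fin k) ι F) (b : ι → F) (z w : ι)
    (hb : ∀ i j, i ≠ z → i ≠ w → j ≠ z → j ≠ w → b i = b j → i = j)
    (hG : ∀ i j, j ≠ z → j ≠ w → G i j = b j ^ (i : ℕ))
    (hz : ∀ i : Fin k, (i : ℕ) ≠ k - 1 → G i z = 0)
    (c : ι → F)
    (hc : ∀ y : ι → F, (∃ x : Fin k → F, y = Matrix.vecMul x G) → ∑ i, c i * y i = 0)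
    (hn : hammingNorm c = k) (hcz : c z ≠ 0) (hcw : c w = 0) : False := by
  classical
  have hS : (Finset.univ.filter (fun i => c i ≠ 0)).card = k := hn
  set S := Finset.univ.filter (fun i => c i ≠ 0) with hSdef
  have hS1 : (S.erase z).card = k - 1 := by
    rw [Finset.card_erase_of_mem (by simp [hSdef, hcz]), hS]
  obtain ⟨j0, hj0⟩ : (S.erase z).Nonempty := by
    rw [← Finset.card_pos]; omega
  have hT : ((S.erase z).erase j0).card = k - 2 := by
    rw [Finset.card_erase_of_mem hj0, hS1]; omega
  set T := (S.erase z).erase j0 with hTdef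
  have hmem : ∀ j, j ∈ S.erase z → j ≠ z ∧ j ≠ w ∧ c j ≠ 0 := by
    intro j hj
    simp only [hSdef, Finset.mem_erase, Finset.mem_filter, Finset.mem_univ, true_and] at hj
    refine ⟨hj.1, ?_, hj.2⟩
    rintro rfl
    exact hj.2 hcw
  set P : F[X] := ∏ j ∈ T, (X - C (b j)) with hP
  have hdeg : P.natDegree = k - 2 := by
    rw [hP, natDegree_prod_of_monic _ _ (fun j _ => monic_X_sub_C _)]
    simp [hT]
  have hv : ∀ j, j ≠ z → j ≠ w →
      Matrix.vecMul (fun i : Fin k => P.coeff i) G j = P.eval (b j) := by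
    intro j h1 h2
    rw [eval_eq_sum_range' (n := k) (by omega), ← Fin.sum_univ_eq_sum_range
      (fun i => P.coeff i * b j ^ i)]
    simp only [Matrix.vecMul, dotProduct]
    exact Finset.sum_congr rfl (fun i _ => by rw [hG i j h1 h2])
  have hvz : Matrix.vecMul (fun i : Fin k => P.coeff i) G z = 0 := by
    simp only [Matrix.vecMul, dotProduct]
    refine Finset.sum_eq_zero (fun i _ => ?_)
    by_cases hi : (i : ℕ) = k - 1
    · rw [coeff_eq_zero_of_natDegree_lt (by omega), zero_mul]
    · rw [hz i hi, mul_zero]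
  have h0 := hc _ ⟨fun i : Fin k => P.coeff i, rfl⟩
  obtain ⟨j1, j2, j3⟩ := hmem j0 hj0
  rw [Finset.sum_eq_single j0, hv j0 j1 j2] at h0
  · rcases mul_eq_zero.1 h0 with h | h
    · exact j3 h
    · rw [hP, eval_prod, Finset.prod_eq_zero_iff] at h
      obtain ⟨j, hj, h⟩ := h
      have hj' := Finset.mem_erase.1 hj
      obtain ⟨l1, l2, -⟩ := hmem j hj'.2
      simp only [eval_sub, eval_X, eval_C, sub_eq_zero] at h
      exact hj'.1 (hb _ _ l1 l2 j1 j2 h.symm)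
  · intro j _ hj
    by_cases hcj : c j = 0
    · rw [hcj, zero_mul]
    by_cases hjz : j = z
    · rw [hjz, hvz, mul_zero]
    have hjw : j ≠ w := by rintro rfl; exact hcj hcw
    have hjT : j ∈ T := by simp [hTdef, hSdef, hj, hjz, hcj]
    rw [hv j hjz hjw, hP, eval_prod, Finset.prod_eq_zero hjT (by simp), mul_zero]
  · intro h; exact absurd (Finset.mem_univ _) h

/-- if a₁₁ = 0 there is no weight-k dual codeword with c_q ≠ 0, c_{q+1} = 0;
if a₁₂ = 0 there is no weight-k dual codeword with c_q = 0, c_{q+1} ≠ 0. -/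
theorem stmt4 (p m q k : ℕ) (hp : p.Prime) (hm : 0 < m) (hq : q = p ^ m)
    (F : Type*) [Field F] [Fintype F] [DecidableEq F] (hF : Fintype.card F = q)
    (hk3 : 3 ≤ k) (hkq : k ≤ q)
    (β : Fin (q - 1) → F) (hβinj : Function.Injective β)
    (hβrange : Set.range β = {x : F | x ≠ 0})
    (a : Matrix (Fin 2) (Fin 2) F) (ha : IsUnit a.det)
    (G₁ : Matrix (Fin k) (Fin (q + 1)) F)
    (hGv : ∀ (i : Fin k) (j : Fin (q + 1)) (h : (j : ℕ) < q - 1),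
      G₁ i j = β ⟨j, h⟩ ^ (i : ℕ))
    (hGc1 : ∀ (i : Fin k) (j : Fin (q + 1)), (j : ℕ) = q - 1 →
      G₁ i j = if (i : ℕ) = k - 2 then a 0 0 else if (i : ℕ) = k - 1 then a 1 0 else 0)
    (hGc2 : ∀ (i : Fin k) (j : Fin (q + 1)), (j : ℕ) = q →
      G₁ i j = if (i : ℕ) = k - 2 then a 0 1 else if (i : ℕ) = k - 1 then a 1 1 else 0) :
    (a 0 0 = 0 →
      ¬ ∃ c : Fin (q + 1) → F,
        (∀ y : Fin (q + 1) → F, (∃ x : Fin k → F, y = Matrix.vecMul x G₁) →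
          ∑ i, c i * y i = 0) ∧
        hammingNorm c = k ∧
        c ⟨q - 1, by omega⟩ ≠ 0 ∧ c ⟨q, by omega⟩ = 0) ∧
    (a 0 1 = 0 →
      ¬ ∃ c : Fin (q + 1) → F,
        (∀ y : Fin (q + 1) → F, (∃ x : Fin k → F, y = Matrix.vecMul x G₁) →
          ∑ i, c i * y i = 0) ∧
        hammingNorm c = k ∧
        c ⟨q - 1, by omega⟩ = 0 ∧ c ⟨q, by omega⟩ ≠ 0) := by
  have hlt : ∀ j : Fin (q + 1), (j : ℕ) ≠ q - 1 → (j : ℕ) ≠ q → (j : ℕ) < q - 1 := by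
    intro j h1 h2
    have := j.2
    omega
  set b : Fin (q + 1) → F := fun j => if h : (j : ℕ) < q - 1 then β ⟨j, h⟩ else 0 with hbdef
  have hbv : ∀ (j : Fin (q + 1)) (h : (j : ℕ) < q - 1), b j = β ⟨j, h⟩ := by
    intro j h
    simp [hbdef, h]
  have hbi : ∀ i j : Fin (q + 1), (i : ℕ) < q - 1 → (j : ℕ) < q - 1 → b i = b j → i = j := by
    intro i j h1 h2 h
    rw [hbv i h1, hbv j h2] at h
    have := hβinj h
    simp only [Fin.mk.injEq] at this
    exact Fin.ext this
  have hne : ∀ (j : Fin (q + 1)) (n : ℕ) (h : n < q + 1), j ≠ ⟨n, h⟩ → (j : ℕ) ≠ n :=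
    fun j n h hj e => hj (Fin.ext e)
  constructor
  · rintro h0 ⟨c, hc, hn, h1, h2⟩
    refine aux_no_codeword k hk3 G₁ b _ _ ?_ ?_ ?_ c hc hn h1 h2
    · intro i j i1 i2 j1 j2
      exact hbi i j (hlt i (hne _ _ _ i1) (hne _ _ _ i2)) (hlt j (hne _ _ _ j1) (hne _ _ _ j2))
    · intro i j j1 j2
      have hj := hlt j (hne _ _ _ j1) (hne _ _ _ j2)
      rw [hGv i j hj, hbv j hj]
    · intro i hi
      rw [hGc1 i _ rfl, h0, if_neg hi, ite_self]
  · rintro h0 ⟨c, hc, hn, h1, h2⟩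
    refine aux_no_codeword k hk3 G₁ b _ _ ?_ ?_ ?_ c hc hn h2 h1
    · intro i j i1 i2 j1 j2
      exact hbi i j (hlt i (hne _ _ _ i2) (hne _ _ _ i1)) (hlt j (hne _ _ _ j2) (hne _ _ _ j1))
    · intro i j j1 j2
      have hj := hlt j (hne _ _ _ j2) (hne _ _ _ j1)
      rw [hGv i j hj, hbv j hj]
    · intro i hi
      rw [hGc2 i _ rfl, h0, if_neg hi, ite_self]
end

section
/- Suppose (p = 2 and 4 ≤ k ≤ q−3) or (p odd and 3 ≤ k ≤ q−2), and suppose a_{11}a_{12}a_{21}a_{22} ≠ 0. Then the minimum distance of RL_k^⊥(F_q^*, M) equals k, and the number of codewords of Hamming weight exactly k in RL_k^⊥(F_q^*, M) equals (2(q−1)/q)·C(q−1, k−1) + (−1)^{k+⌊(k−1)/p⌋}·(2(q−1)/q)·C(q/p − 1, ⌊(k−1)/p⌋), where C(·,·) denotes the binomial coefficient. -/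
section helpers
open Polynomial

set_option linter.unusedSectionVars false
section
variable {F ι : Type*} [Field F] [DecidableEq F] [Fintype ι] [DecidableEq ι]

/-- the moment conditions. -/
def Mom (β : ι → F) (N : ℕ) (f : ι → F) (s t : F) : Prop :=
  ∀ i < N + 2, ∑ x, f x * β x ^ i = if i = N then s else if i = N + 1 then t else 0

lemma Mom.poly {β : ι → F} {N : ℕ} {f : ι → F} {s t : F} (h : Mom β N f s t)
    (P : F[X]) (hP : P.natDegree < N + 2) :
    ∑ x, f x * P.eval (β x) = s * P.coeff N + t * P.coeff (N + 1) := by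
  have : ∀ x, P.eval (β x) = ∑ i ∈ Finset.range (N + 2), P.coeff i * β x ^ i := fun x =>
    Polynomial.eval_eq_sum_range' hP _
  simp_rw [this, Finset.mul_sum]
  rw [Finset.sum_comm]
  have : ∀ i ∈ Finset.range (N + 2), ∑ x, f x * (P.coeff i * β x ^ i)
      = P.coeff i * (if i = N then s else if i = N + 1 then t else 0) := by
    intro i hi
    rw [← h i (Finset.mem_range.1 hi), Finset.mul_sum]
    exact Finset.sum_congr rfl fun x _ => by ring
  rw [Finset.sum_congr rfl this, Finset.sum_range_succ, Finset.sum_range_succ,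
    Finset.sum_eq_zero]
  · simp; ring
  · intro i hi
    have := Finset.mem_range.1 hi
    rw [if_neg (by omega), if_neg (by omega), mul_zero]

lemma Mom.erase {β : ι → F} {N : ℕ} {f : ι → F} {s t : F} (h : Mom β N f s t)
    (S : Finset ι) (hS : ∀ x, x ∉ S → f x = 0) (x : ι) (hx : x ∈ S) (hc : S.card < N + 3) :
    f x * (Lagrange.nodal (S.erase x) β).eval (β x) =
      s * (Lagrange.nodal (S.erase x) β).coeff N
       + t * (Lagrange.nodal (S.erase x) β).coeff (N + 1) := by
  rw [← h.poly]
  · rw [Finset.sum_eq_single x]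
    · intro y _ hy
      by_cases hyS : y ∈ S
      · rw [Lagrange.eval_nodal_at_node (by simp [hy, hyS]), mul_zero]
      · rw [hS y hyS, zero_mul]
    · simp
  · rw [Lagrange.natDegree_nodal, Finset.card_erase_of_mem hx]; omega

lemma nodal_erase_ne {β : ι → F} (hβ : Function.Injective β) (S : Finset ι) (x : ι) :
    (Lagrange.nodal (S.erase x) β).eval (β x) ≠ 0 :=
  Lagrange.eval_nodal_not_at_node fun y hy => fun e => by
    have := hβ e; subst this; simp at hy

lemma coeff_nodal_big {β : ι → F} (S : Finset ι) (x : ι) (hx : x ∈ S) (N : ℕ) (h : S.card < N + 1) :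
    (Lagrange.nodal (S.erase x) β).coeff N = 0 := by
  apply coeff_eq_zero_of_natDegree_lt
  rw [Lagrange.natDegree_nodal, Finset.card_erase_of_mem hx]
  have := Finset.card_pos.2 ⟨x, hx⟩
  omega

lemma Mom.card0 {β : ι → F} (hβ : Function.Injective β) {N : ℕ} {f : ι → F}
    (h : Mom β N f 0 0) (hf : f ≠ 0) : N + 3 ≤ hammingNorm f := by
  by_contra! hc
  obtain ⟨x, hx⟩ := Function.ne_iff.1 hf
  have := h.erase {x | f x ≠ 0} (by simp) x (by simpa using hx) hc
  simp only [zero_mul, add_zero, mul_eq_zero] at this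
  exact this.elim hx (nodal_erase_ne hβ _ _)

lemma Mom.card1 {β : ι → F} (hβ : Function.Injective β) {N : ℕ} {f : ι → F} {s t : F}
    (h : Mom β N f s t) (hf : f ≠ 0) : N + 1 ≤ hammingNorm f := by
  by_contra! hc
  obtain ⟨x, hx⟩ := Function.ne_iff.1 hf
  have := h.erase {x | f x ≠ 0} (by simp) x (by simpa using hx)
    (by unfold hammingNorm at hc; omega)
  rw [coeff_nodal_big _ _ (by simpa using hx) _ (by unfold hammingNorm at hc; omega),
    coeff_nodal_big _ _ (by simpa using hx) _ (by unfold hammingNorm at hc; omega)] at this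
  simp only [mul_zero, add_zero, mul_eq_zero] at this
  exact this.elim hx (nodal_erase_ne hβ _ _)

/-- weight vector -/
noncomputable def wv (β : ι → F) (S : Finset ι) (s : F) (x : ι) : F :=
  if x ∈ S then s * Lagrange.nodalWeight S β x else 0

lemma Mom.eq {β : ι → F} (hβ : Function.Injective β) {N : ℕ} {f : ι → F} {s t : F}
    (h : Mom β N f s t) (hf : hammingNorm f = N + 1) :
    f = wv β {x | f x ≠ 0} s ∧ t = s * ∑ x with f x ≠ 0, β x := by
  constructor
  · funext x
    unfold wv
    split_ifs with hx
    · have := h.erase {x | f x ≠ 0} (by simp) x hx (by unfold hammingNorm at hf; omega)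
      rw [coeff_nodal_big _ _ hx (N+1) (by unfold hammingNorm at hf; omega)] at this
      have h1 : (Lagrange.nodal (({x | f x ≠ 0} : Finset ι).erase x) β).coeff N = 1 := by
        have := (Lagrange.nodal_monic (s := ({x | f x ≠ 0} : Finset ι).erase x) (v := β)).coeff_natDegree
        rw [Lagrange.natDegree_nodal, Finset.card_erase_of_mem hx] at this
        unfold hammingNorm at hf
        rwa [hf] at this
      rw [h1, mul_one, mul_zero, add_zero] at this
      rw [Lagrange.nodalWeight_eq_eval_nodal_erase_inv, ← this, mul_assoc,
        mul_inv_cancel₀ (nodal_erase_ne hβ _ _), mul_one]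
    · simpa using hx
  · have := h.poly (Lagrange.nodal {x | f x ≠ 0} β) (by
      rw [Lagrange.natDegree_nodal]; unfold hammingNorm at hf; omega)
    have h1 : (Lagrange.nodal ({x | f x ≠ 0} : Finset ι) β).coeff (N + 1) = 1 := by
        have := (Lagrange.nodal_monic (s := ({x | f x ≠ 0} : Finset ι)) (v := β)).coeff_natDegree
        rw [Lagrange.natDegree_nodal] at this
        unfold hammingNorm at hf
        rwa [hf] at this
    have h2 : (Lagrange.nodal ({x | f x ≠ 0} : Finset ι) β).coeff N = - ∑ x with f x ≠ 0, β x := by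
        have := Polynomial.prod_X_sub_C_coeff_card_pred ({x | f x ≠ 0} : Finset ι) β
          (by unfold hammingNorm at hf; omega)
        unfold hammingNorm at hf
        rwa [hf, Nat.add_sub_cancel] at this
    rw [h1, h2, Finset.sum_eq_zero] at this
    · linear_combination -this
    · intro x _
      by_cases hx : f x = 0
      · simp [hx]
      · rw [Lagrange.eval_nodal_at_node (by simpa using hx), mul_zero]

lemma mom_wv {β : ι → F} (hβ : Function.Injective β) {N : ℕ} (S : Finset ι) (hS : S.card = N + 1)
    (s : F) : Mom β N (wv β S s) s (s * ∑ x ∈ S, β x) := by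
  -- low-degree polynomials
  have low : ∀ P : F[X], P.degree < S.card →
      ∑ x, wv β S s x * P.eval (β x) = s * P.coeff N := by
    intro P hP
    have := Lagrange.coeff_eq_sum (s := S) (v := β) hβ.injOn hP
    rw [hS, Nat.add_sub_cancel] at this
    rw [this, Finset.mul_sum]
    unfold wv
    simp only [ite_mul, zero_mul]
    rw [Finset.sum_ite_mem, Finset.univ_inter]
    refine Finset.sum_congr rfl fun x _ => ?_
    rw [Lagrange.nodalWeight, Finset.prod_inv_distrib]
    ring
  intro i hi
  have main : ∑ x, wv β S s x * β x ^ i = s * (X ^ i : F[X]).coeff N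
      + s * (∑ x ∈ S, β x) * (X ^ i : F[X]).coeff (N + 1) := by
    by_cases hi' : i = N + 1
    · subst hi'
      have hc : (Lagrange.nodal S β).coeff N = - ∑ x ∈ S, β x := by
        have := Polynomial.prod_X_sub_C_coeff_card_pred S β (by omega)
        rwa [hS, Nat.add_sub_cancel] at this
      have h1 := low (X ^ (N + 1) - Lagrange.nodal S β) (by
        rw [hS, ← degree_X_pow (R := F) (N + 1)]
        apply degree_sub_lt_left
        · rw [degree_X_pow, Lagrange.degree_nodal, hS]
        · exact pow_ne_zero _ X_ne_zero
        · rw [leadingCoeff_X_pow, Lagrange.nodal_monic.leadingCoeff])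
      rw [coeff_sub, hc] at h1
      have h2 : ∑ x, wv β S s x * β x ^ (N + 1) =
          ∑ x, wv β S s x * (X ^ (N + 1) - Lagrange.nodal S β).eval (β x) := by
        refine Finset.sum_congr rfl fun x _ => ?_
        by_cases hx : x ∈ S
        · rw [eval_sub, Lagrange.eval_nodal_at_node hx]; simp
        · simp [wv, hx]
      rw [h2, h1, coeff_X_pow, coeff_X_pow]
      simp
    · have h1 := low (X ^ i) (by
        rw [hS, degree_X_pow]; exact_mod_cast (by omega))
      simp only [eval_pow, eval_X] at h1
      rw [h1, coeff_X_pow, coeff_X_pow, if_neg (Ne.symm hi'), mul_zero, add_zero]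
  rw [main]
  simp only [coeff_X_pow]
  split_ifs <;> first | omega | simp

lemma supp_wv {β : ι → F} (hβ : Function.Injective β) (S : Finset ι) {s : F} (hs : s ≠ 0) :
    ({x | wv β S s x ≠ 0} : Finset ι) = S := by
  ext x
  by_cases hx : x ∈ S
  · simp [wv, hx, hs, Lagrange.nodalWeight_ne_zero hβ.injOn hx]
  · simp [wv, hx]

end

section count

lemma coeff_one_sub_X_pow' (M j : ℕ) : ((1 - X : ℂ[X]) ^ M).coeff j = (-1) ^ j * (M.choose j : ℂ) := by
  have : (1 - X : ℂ[X]) ^ M = ((1 + X : ℂ[X]) ^ M).comp (C (-1) * X) := by simp [sub_eq_add_neg]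
  rw [this, comp_C_mul_X_coeff, coeff_one_add_X_pow, mul_comm]

lemma coeff_Q (p M n : ℕ) (hp : 0 < p) :
    ((1 - X ^ p : ℂ[X]) ^ M * ∑ i ∈ Finset.range p, X ^ i).coeff n
      = (-1) ^ (n / p) * (M.choose (n / p) : ℂ) := by
  have h1 : (1 - X ^ p : ℂ[X]) ^ M = expand ℂ p ((1 - X) ^ M) := by simp
  rw [h1, Finset.mul_sum, finsetSum_coeff, Finset.sum_eq_single (n % p)]
  · rw [coeff_mul_X_pow', if_pos (Nat.mod_le _ _), coeff_expand hp, if_pos (Nat.dvd_sub_mod _),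
      coeff_one_sub_X_pow']
    have : (n - n % p) / p = n / p := by
      rw [Nat.div_eq_sub_mod_div (m := n)]
    rw [this]
  · intro i hi hne
    rw [coeff_mul_X_pow']
    split_ifs with hin
    · rw [coeff_expand hp, if_neg]
      intro hd
      apply hne
      have := (Nat.modEq_iff_dvd' hin).2 hd
      unfold Nat.ModEq at this
      rw [Nat.mod_eq_of_lt (Finset.mem_range.1 hi)] at this
      exact this
    · rfl
  · intro h; exact absurd (Finset.mem_range.2 (Nat.mod_lt _ hp)) h

lemma prod_zmod (p : ℕ) [Fact p.Prime] (ζ : ℂ) (hζ : IsPrimitiveRoot ζ p) :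
    ∏ c : ZMod p, (1 - C (AddChar.zmodChar p hζ.pow_eq_one c) * X : ℂ[X]) = 1 - X ^ p := by
  have hp : 0 < p := (Fact.out : p.Prime).pos
  have hζ' : IsPrimitiveRoot (C ζ : ℂ[X]) p := hζ.map_of_injective C_injective
  have := hζ'.pow_sub_pow_eq_prod_sub_mul (1 : ℂ[X]) X hp
  rw [one_pow] at this
  rw [this]
  have inj : Function.Injective fun c : ZMod p => (C (AddChar.zmodChar p hζ.pow_eq_one c) : ℂ[X]) := by
    intro c d h
    have h := C_injective h
    rw [AddChar.zmodChar_apply, AddChar.zmodChar_apply] at h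
    exact ZMod.val_injective p (hζ.pow_inj (ZMod.val_lt c) (ZMod.val_lt d) h)
  have im : (Finset.univ.image fun c : ZMod p => (C (AddChar.zmodChar p hζ.pow_eq_one c) : ℂ[X]))
      = nthRootsFinset p (1 : ℂ[X]) := by
    apply Finset.eq_of_subset_of_card_le
    · intro y hy
      obtain ⟨c, _, rfl⟩ := Finset.mem_image.1 hy
      rw [mem_nthRootsFinset hp, AddChar.zmodChar_apply, ← C_pow, ← pow_mul, mul_comm, pow_mul,
        hζ.pow_eq_one, one_pow, C_1]
    · rw [hζ'.card_nthRootsFinset, Finset.card_image_of_injective _ inj, Finset.card_univ, ZMod.card]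
  rw [← im, Finset.prod_image inj.injOn]

variable {F : Type*} [Field F] [Fintype F] [DecidableEq F]

/-- number of n-subsets of F^* with given sum -/
def NN (F : Type*) [Field F] [Fintype F] [DecidableEq F] (n : ℕ) (γ : F) : ℕ :=
  (((Finset.univ.erase (0:F)).powersetCard n).filter fun S => ∑ x ∈ S, x = γ).card

lemma NN_mul (n : ℕ) (μ γ : F) (hμ : μ ≠ 0) : NN F n γ ≤ NN F n (μ * γ) := by
  unfold NN
  have inj : Function.Injective (fun x : F => μ * x) := mul_right_injective₀ hμ
  apply Finset.card_le_card_of_injOn (fun S => S.map ⟨_, inj⟩)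
  · intro S hS
    simp only [Finset.coe_filter, Finset.mem_powersetCard, Set.mem_ofPred_eq] at hS ⊢
    obtain ⟨⟨h1, h2⟩, h3⟩ := hS
    refine ⟨⟨?_, by rw [Finset.card_map, h2]⟩, ?_⟩
    · intro y hy
      obtain ⟨x, hx, rfl⟩ := Finset.mem_map.1 hy
      have := h1 hx
      simp at this ⊢
      exact ⟨hμ, this⟩
    · rw [Finset.sum_map, ← h3, Finset.mul_sum]; rfl
  · exact (Finset.map_injective _).injOn

lemma NN_eq (n : ℕ) (γ δ : F) (hγ : γ ≠ 0) (hδ : δ ≠ 0) : NN F n γ = NN F n δ := by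
  apply le_antisymm
  · have := NN_mul n (δ / γ) γ (div_ne_zero hδ hγ)
    rwa [div_mul_cancel₀ _ hγ] at this
  · have := NN_mul n (γ / δ) δ (div_ne_zero hγ hδ)
    rwa [div_mul_cancel₀ _ hδ] at this

lemma NN_sum (n : ℕ) : ∑ γ : F, NN F n γ = (Fintype.card F - 1).choose n := by
  unfold NN
  rw [← Finset.card_eq_sum_card_fiberwise (by intro x _; simp), Finset.card_powersetCard,
    Finset.card_erase_of_mem (Finset.mem_univ _), Finset.card_univ]

lemma addChar_sum (ψ : AddChar F ℂ) (S : Finset F) : ψ (∑ x ∈ S, x) = ∏ x ∈ S, ψ x := by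
  induction S using Finset.induction_on with
  | empty => simp
  | insert x S hx ih => rw [Finset.sum_insert hx, Finset.prod_insert hx, AddChar.map_add_eq_mul, ih]

lemma char_sum (n : ℕ) (ψ : AddChar F ℂ) :
    ∑ γ : F, (NN F n γ : ℂ) * ψ γ
      = (-1) ^ n * (∏ x ∈ Finset.univ.erase (0:F), (1 - C (ψ x) * X : ℂ[X])).coeff n := by
  have h1 : ∏ x ∈ Finset.univ.erase (0:F), (1 - C (ψ x) * X : ℂ[X]) =
      ∑ S ∈ (Finset.univ.erase (0:F)).powerset, C ((-1) ^ S.card * ψ (∑ x ∈ S, x)) * X ^ S.card := by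
    simp_rw [sub_eq_add_neg]
    rw [Finset.prod_one_add]
    refine Finset.sum_congr rfl fun S _ => ?_
    rw [addChar_sum, C_mul, map_prod]
    simp_rw [← neg_mul]
    rw [Finset.prod_mul_distrib, Finset.prod_neg]
    simp
  rw [h1, finsetSum_coeff]
  simp_rw [coeff_C_mul, coeff_X_pow, mul_ite, mul_one, mul_zero]
  rw [← Finset.sum_filter]
  have h2 : (Finset.univ.erase (0:F)).powerset.filter (fun S => n = S.card) =
      (Finset.univ.erase (0:F)).powersetCard n := by
    rw [Finset.powersetCard_eq_filter]; simp_rw [eq_comm]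
  rw [h2, Finset.mul_sum]
  have h3 : ∀ S ∈ (Finset.univ.erase (0:F)).powersetCard n,
      (-1 : ℂ) ^ n * ((-1) ^ S.card * ψ (∑ x ∈ S, x)) = ψ (∑ x ∈ S, x) := by
    intro S hS
    rw [(Finset.mem_powersetCard.1 hS).2, ← mul_assoc, ← pow_add, ← two_mul, pow_mul]
    simp
  rw [Finset.sum_congr rfl h3, ← Finset.sum_fiberwise _ (fun S => ∑ x ∈ S, x)]
  refine Finset.sum_congr rfl fun γ _ => ?_
  rw [Finset.sum_congr rfl (g := fun _ => ψ γ)]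
  · simp [NN]
  · intro S hS
    rw [(Finset.mem_filter.1 hS).2]

lemma NN_diff (p m n : ℕ) (hp : p.Prime) (hm : 0 < m) (hF : Fintype.card F = p ^ m) (γ : F)
    (hγ : γ ≠ 0) : (NN F n 0 : ℂ) - NN F n γ
      = (-1) ^ (n + n / p) * ((p ^ m / p - 1).choose (n / p) : ℂ) := by
  have : Fact p.Prime := ⟨hp⟩
  have : CharP F p := charP_of_card_eq_prime_pow hF
  let : Algebra (ZMod p) F := ZMod.algebra F p
  have hζ := Complex.isPrimitiveRoot_exp p hp.ne_zero
  set e := AddChar.zmodChar p hζ.pow_eq_one with he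
  have tsurj := Algebra.trace_surjective (ZMod p) F
  set tr := Algebra.trace (ZMod p) F
  let ψ : AddChar F ℂ := e.compAddMonoidHom tr.toAddMonoidHom
  have hψ : ∀ x, ψ x = e (tr x) := fun x => rfl
  have hψ1 : ψ ≠ 1 := by
    intro h
    obtain ⟨x, hx⟩ := tsurj 1
    have h1 : ψ x = 1 := by rw [h]; rfl
    have h2 := AddChar.zmodChar_apply' hζ.pow_eq_one 1
    rw [Nat.cast_one, pow_one] at h2
    rw [hψ, hx, he, h2] at h1
    exact hζ.ne_one hp.one_lt h1
  have hsum := AddChar.sum_eq_zero_of_ne_one hψ1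
  -- fibres
  have hfib : ∀ c : ZMod p, (Finset.univ.filter fun x : F => tr x = c).card = p ^ m / p := by
    have h0 : ∀ c : ZMod p, (Finset.univ.filter fun x : F => tr x = c).card
        = (Finset.univ.filter fun x : F => tr x = 0).card := fun c =>
      AddMonoidHom.card_fiber_eq_of_mem_range tr.toAddMonoidHom (tsurj c) (tsurj 0)
    have h1 := Finset.card_eq_sum_card_fiberwise (f := tr) (s := Finset.univ) (t := Finset.univ)
      (by intro x _; simp)
    rw [Finset.sum_congr rfl (fun c _ => h0 c), Finset.sum_const, Finset.card_univ, Finset.card_univ,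
      hF, ZMod.card, smul_eq_mul] at h1
    intro c
    rw [h0 c, h1, Nat.mul_div_cancel_left _ hp.pos]
  have hprod : ∏ x : F, (1 - C (ψ x) * X : ℂ[X]) = (1 - X ^ p) ^ (p ^ m / p) := by
    rw [← prod_zmod p _ hζ, ← Finset.prod_pow, ← Finset.prod_fiberwise _ tr]
    refine Finset.prod_congr rfl fun c _ => ?_
    rw [← hfib c, ← Finset.prod_const]
    refine Finset.prod_congr rfl fun x hx => ?_
    rw [hψ, (Finset.mem_filter.1 hx).2]
  have hM : 0 < p ^ m / p := Nat.div_pos (Nat.le_self_pow hm.ne' p) hp.pos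
  have hprod' : ∏ x ∈ Finset.univ.erase (0:F), (1 - C (ψ x) * X : ℂ[X]) =
      (1 - X ^ p) ^ (p ^ m / p - 1) * ∑ i ∈ Finset.range p, X ^ i := by
    have hne : (1 - X : ℂ[X]) ≠ 0 := by
      intro h
      have := congrArg (eval 0) h
      simp at this
    apply mul_left_cancel₀ hne
    have h1 := Finset.mul_prod_erase Finset.univ (fun x : F => (1 - C (ψ x) * X : ℂ[X]))
      (Finset.mem_univ 0)
    rw [hprod] at h1
    simp only [AddChar.map_zero_eq_one, C_1, one_mul] at h1
    rw [h1]
    have h2 : (1 - X : ℂ[X]) * ∑ i ∈ Finset.range p, X ^ i = 1 - X ^ p := by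
      exact mul_neg_geom_sum X p
    rw [mul_left_comm, h2, ← pow_succ, Nat.sub_add_cancel hM]
  have hcs := char_sum n ψ
  rw [hprod', coeff_Q p _ n hp.pos, ← Finset.add_sum_erase _ _ (Finset.mem_univ 0)] at hcs
  rw [← Finset.add_sum_erase _ _ (Finset.mem_univ 0)] at hsum
  rw [Finset.sum_congr rfl (g := fun x => (NN F n γ : ℂ) * ψ x), ← Finset.mul_sum] at hcs
  · rw [AddChar.map_zero_eq_one] at hsum hcs
    rw [pow_add]
    linear_combination hcs - (NN F n γ : ℂ) * hsum
  · intro x hx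
    rw [NN_eq n x γ (by simpa using hx) hγ]

lemma NN_formula (p m n : ℕ) (hp : p.Prime) (hm : 0 < m) (hF : Fintype.card F = p ^ m) (γ : F)
    (hγ : γ ≠ 0) : ((p ^ m : ℕ) : ℚ) * NN F n γ = ((p ^ m - 1).choose n : ℚ)
      - (-1) ^ (n + n / p) * ((p ^ m / p - 1).choose (n / p) : ℚ) := by
  have h1 := NN_diff p m n hp hm hF γ hγ
  have h1' : (NN F n 0 : ℚ) - NN F n γ
      = (-1) ^ (n + n / p) * ((p ^ m / p - 1).choose (n / p) : ℚ) := by exact_mod_cast h1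
  have h2 := NN_sum (F := F) n
  rw [← Finset.add_sum_erase _ _ (Finset.mem_univ 0),
    Finset.sum_congr rfl (g := fun x => NN F n γ) (fun x hx => NN_eq n x γ (by simpa using hx) hγ),
    Finset.sum_const, Finset.card_erase_of_mem (Finset.mem_univ _), Finset.card_univ, hF,
    smul_eq_mul] at h2
  have hpos : 1 ≤ p ^ m := Nat.one_le_pow _ _ hp.pos
  have h2' : (NN F n 0 : ℚ) + (((p ^ m : ℕ) : ℚ) - 1) * NN F n γ = ((p ^ m - 1).choose n : ℚ) := by
    rw [← h2]; push_cast [Nat.cast_sub hpos]; ring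
  linear_combination h2' - h1'

lemma NN_pos (n : ℕ) (hn : 1 ≤ n) (hn' : n + 2 ≤ Fintype.card F) (γ : F)
    (hγ : γ ≠ 0) : 0 < NN F n γ := by
  -- a set of size n+1 in F^*, remove different elements
  obtain ⟨T, hT, hTc⟩ := Finset.exists_subset_card_eq (s := Finset.univ.erase (0:F)) (n := n + 1) (by
    rw [Finset.card_erase_of_mem (Finset.mem_univ _), Finset.card_univ]; omega)
  obtain ⟨x, hx, y, hy, hxy⟩ := Finset.one_lt_card.1 (by omega : 1 < T.card)
  have key : ∀ z ∈ T, ∑ w ∈ T.erase z, w ≠ 0 → 0 < NN F n γ := by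
    intro z hz h
    rw [NN_eq n γ _ hγ h]
    apply Finset.card_pos.2
    refine ⟨T.erase z, ?_⟩
    rw [Finset.mem_filter, Finset.mem_powersetCard]
    exact ⟨⟨(Finset.erase_subset _ _).trans hT, by rw [Finset.card_erase_of_mem hz]; omega⟩, rfl⟩
  by_contra hc
  have hx0 : ∑ w ∈ T.erase x, w = 0 := by by_contra h; exact hc (key x hx h)
  have hy0 : ∑ w ∈ T.erase y, w = 0 := by by_contra h; exact hc (key y hy h)
  have e1 := Finset.add_sum_erase T (fun w => w) hx
  have e2 := Finset.add_sum_erase T (fun w => w) hy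
  simp only [hx0, hy0, add_zero] at e1 e2
  exact hxy (e1.trans e2.symm)

/-- indexed version -/
lemma NN_index {ι : Type*} [Fintype ι] [DecidableEq ι] (β : ι → F) (hβ : Function.Injective β)
    (hr : Set.range β = {x | x ≠ 0}) (n : ℕ) (γ : F) :
    (Finset.univ.filter fun S : Finset ι => S.card = n ∧ ∑ x ∈ S, β x = γ).card = NN F n γ := by
  unfold NN
  apply Finset.card_bij (fun S _ => S.map ⟨β, hβ⟩)
  · intro S hS
    simp only [Finset.mem_filter, Finset.mem_powersetCard, Finset.mem_univ, true_and] at hS ⊢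
    refine ⟨⟨?_, by rw [Finset.card_map, hS.1]⟩, ?_⟩
    · intro y hy
      obtain ⟨x, hx, rfl⟩ := Finset.mem_map.1 hy
      have : β x ∈ {x : F | x ≠ 0} := hr ▸ Set.mem_range_self x
      simpa using this
    · rw [Finset.sum_map]; exact hS.2
  · intro S _ T _ h
    exact Finset.map_injective _ h
  · intro T hT
    simp only [Finset.mem_filter, Finset.mem_powersetCard] at hT
    have hm : (Finset.univ.filter fun x => β x ∈ T).map ⟨β, hβ⟩ = T := by
      ext y
      simp only [Finset.mem_map, Finset.mem_filter, Finset.mem_univ, true_and,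
        Function.Embedding.coeFn_mk]
      constructor
      · rintro ⟨x, hx, rfl⟩; exact hx
      · intro hy
        have h0 := hT.1.1 hy
        have : y ∈ Set.range β := by rw [hr]; simpa using h0
        obtain ⟨x, rfl⟩ := this
        exact ⟨x, hy, rfl⟩
    refine ⟨_, ?_, hm⟩
    simp only [Finset.mem_filter, Finset.mem_univ, true_and]
    constructor
    · rw [← hT.1.2, ← Finset.card_map ⟨β, hβ⟩, hm]
    · rw [← hT.2]; conv_rhs => rw [← hm, Finset.sum_map]
      rfl
end count

section final
variable {F ι : Type*} [Field F] [Fintype F] [DecidableEq F] [Fintype ι] [DecidableEq ι]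

/-- indicator weight of one coordinate -/
def w1 (u : F) : ℕ := if u ≠ 0 then 1 else 0

lemma weight_ge {β : ι → F} (hβ : Function.Injective β) (N : ℕ) (a b c d : F)
    (hdet : a * d - b * c ≠ 0) (f : ι → F) (u v : F)
    (h : Mom β N f (-(u * a + v * b)) (-(u * c + v * d))) (hne : ¬ (f = 0 ∧ u = 0 ∧ v = 0)) :
    (u ≠ 0 ∨ v ≠ 0) ∧ N + 1 ≤ hammingNorm f ∨ (u = 0 ∧ v = 0) ∧ N + 3 ≤ hammingNorm f := by
  by_cases huv : u = 0 ∧ v = 0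
  · right
    refine ⟨huv, ?_⟩
    obtain ⟨rfl, rfl⟩ := huv
    simp only [zero_mul, add_zero, neg_zero] at h
    exact h.card0 hβ (by tauto)
  · left
    refine ⟨by tauto, h.card1 hβ ?_⟩
    rintro rfl
    have h1 := h N (by omega)
    have h2 := h (N + 1) (by omega)
    simp at h1 h2
    apply huv
    have hu : u * (a * d - b * c) = 0 := by linear_combination d * h1 - b * h2
    have hv : v * (a * d - b * c) = 0 := by linear_combination a * h2 - c * h1
    exact ⟨(mul_eq_zero.1 hu).resolve_right hdet, (mul_eq_zero.1 hv).resolve_right hdet⟩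

/-- words supported at one of the extra coordinates -/
def W1 (β : ι → F) (N : ℕ) (a c : F) : Set ((ι → F) × F) :=
  {x | x.2 ≠ 0 ∧ Mom β N x.1 (-(x.2 * a)) (-(x.2 * c)) ∧ hammingNorm x.1 = N + 1}

lemma W1_card {β : ι → F} (hβ : Function.Injective β) (hr : Set.range β = {x | x ≠ 0})
    (N : ℕ) (a c : F) (ha : a ≠ 0) :
    (W1 β N a c).ncard = NN F (N + 1) (c / a) * (Fintype.card F - 1) := by
  have : W1 β N a c = ↑(((Finset.univ.filter fun S : Finset ι => S.card = N + 1 ∧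
      ∑ x ∈ S, β x = c / a) ×ˢ (Finset.univ.erase (0 : F))).image
        fun z => (wv β z.1 (-(z.2 * a)), z.2)) := by
    ext ⟨f, u⟩
    simp only [W1, Set.mem_ofPred_eq, Finset.coe_image, Set.mem_image, Finset.mem_coe,
      Finset.mem_product, Finset.mem_filter, Finset.mem_univ, true_and, Finset.mem_erase, and_true,
      Prod.exists, Prod.mk.injEq]
    constructor
    · rintro ⟨hu, hM, hf⟩
      obtain ⟨h1, h2⟩ := hM.eq hβ hf
      refine ⟨_, u, ⟨⟨hf, ?_⟩, hu⟩, h1.symm, rfl⟩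
      rw [eq_div_iff ha]
      apply mul_left_cancel₀ hu
      linear_combination h2
    · rintro ⟨S, u', ⟨⟨hS, hsum⟩, hu⟩, rfl, rfl⟩
      refine ⟨hu, ?_, ?_⟩
      · have := mom_wv hβ S hS (-(u' * a))
        rw [hsum] at this
        convert this using 1
        field_simp
      · unfold hammingNorm
        rw [supp_wv hβ S (neg_ne_zero.2 (mul_ne_zero hu ha)), hS]
  rw [this, Set.ncard_coe_finset, Finset.card_image_of_injOn, Finset.card_product,
    NN_index β hβ hr, Finset.card_erase_of_mem (Finset.mem_univ _), Finset.card_univ]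
  rintro ⟨S, u⟩ hS ⟨T, v⟩ hT h
  simp only [Finset.coe_product, Set.mem_prod, Finset.mem_coe, Finset.mem_erase] at hS hT
  simp only [Prod.mk.injEq] at h
  obtain ⟨h1, rfl⟩ := h
  have hu : -(u * a) ≠ 0 := neg_ne_zero.2 (mul_ne_zero hS.2.1 ha)
  have e1 := supp_wv hβ S hu
  rw [h1, supp_wv hβ T hu] at e1
  rw [e1]

/-- the words of weight k -/
def WW (β : ι → F) (N : ℕ) (a b c d : F) : Set ((ι → F) × F × F) :=
  {x | Mom β N x.1 (-(x.2.1 * a + x.2.2 * b)) (-(x.2.1 * c + x.2.2 * d)) ∧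
    hammingNorm x.1 + w1 x.2.1 + w1 x.2.2 = N + 2}

lemma WW_card {β : ι → F} (hβ : Function.Injective β) (hr : Set.range β = {x | x ≠ 0})
    (N : ℕ) (a b c d : F) (hdet : a * d - b * c ≠ 0) (ha : a ≠ 0) (hb : b ≠ 0) (hc : c ≠ 0)
    (hd : d ≠ 0) :
    (WW β N a b c d).ncard = 2 * (NN F (N + 1) 1 * (Fintype.card F - 1)) := by
  have : WW β N a b c d = (fun x : (ι → F) × F => (x.1, x.2, (0 : F))) '' W1 β N a c ∪
      (fun x : (ι → F) × F => (x.1, (0 : F), x.2)) '' W1 β N b d := by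
    ext ⟨f, u, v⟩
    simp only [WW, W1, Set.mem_ofPred_eq, Set.mem_union, Set.mem_image, Prod.exists, Prod.mk.injEq]
    constructor
    · rintro ⟨hM, hw⟩
      have hge := weight_ge hβ N a b c d hdet f u v hM (by
        rintro ⟨rfl, rfl, rfl⟩; simp [w1] at hw)
      by_cases hu : u = 0
      · right
        subst hu
        by_cases hv : v = 0
        · subst hv; simp [w1] at hge hw; omega
        · refine ⟨f, v, ⟨hv, by simpa using hM, ?_⟩, rfl, rfl, rfl⟩
          simp [w1, hv] at hw; omega
      · left
        by_cases hv : v = 0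
        · subst hv
          refine ⟨f, u, ⟨hu, by simpa using hM, ?_⟩, rfl, rfl, rfl⟩
          simp [w1, hu] at hw; omega
        · simp [w1, hu, hv] at hge hw; omega
    · rintro (⟨f', u', ⟨h1, h2, h3⟩, rfl, rfl, rfl⟩ | ⟨f', u', ⟨h1, h2, h3⟩, rfl, rfl, rfl⟩)
      · simp [w1, h1, h2, h3]
      · simp [w1, h1, h2, h3]
  rw [this, Set.ncard_union_eq, Set.ncard_image_of_injective, Set.ncard_image_of_injective,
    W1_card hβ hr N a c ha, W1_card hβ hr N b d hb, NN_eq _ (c / a) 1 (div_ne_zero hc ha) one_ne_zero,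
    NN_eq _ (d / b) 1 (div_ne_zero hd hb) one_ne_zero]
  · ring
  · rintro ⟨f, u⟩ ⟨g, v⟩ h; simpa using h
  · rintro ⟨f, u⟩ ⟨g, v⟩ h; simpa using h
  · rw [Set.disjoint_left]
    rintro _ ⟨⟨f, u⟩, ⟨h1, _⟩, rfl⟩ ⟨⟨g, v⟩, ⟨h2, _⟩, h⟩
    simp only [Prod.mk.injEq] at h
    exact h1 h.2.1.symm

/-- splitting a word -/
def spl {r : ℕ} (c : Fin (r + 2) → F) : (Fin r → F) × F × F :=
  (fun x => c x.castSucc.castSucc, c (Fin.last r).castSucc, c (Fin.last (r + 1)))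

lemma spl_bij {r : ℕ} : Function.Bijective (spl : (Fin (r + 2) → F) → _) := by
  constructor
  · intro c d h
    simp only [spl, Prod.mk.injEq] at h
    funext j
    refine Fin.lastCases h.2.2 (fun j => ?_) j
    refine Fin.lastCases h.2.1 (fun j => ?_) j
    exact congrFun h.1 j
  · rintro ⟨f, u, v⟩
    refine ⟨Fin.snoc (α := fun _ => F) (Fin.snoc (α := fun _ => F) f u) v, ?_⟩
    simp [spl]

lemma spl_norm {r : ℕ} (c : Fin (r + 2) → F) :
    hammingNorm c = hammingNorm (spl c).1 + w1 (spl c).2.1 + w1 (spl c).2.2 := by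
  simp only [hammingNorm, Finset.card_filter]
  rw [Fin.sum_univ_castSucc, Fin.sum_univ_castSucc]
  rfl

lemma core (r N : ℕ) (hcard : Fintype.card F = r + 1) (hN : N + 3 ≤ r + 1)
    (β : Fin r → F) (hβ : Function.Injective β) (hr : Set.range β = {x | x ≠ 0})
    (a b c d : F) (hdet : a * d - b * c ≠ 0) (ha : a ≠ 0) (hb : b ≠ 0) (hc : c ≠ 0)
    (hd : d ≠ 0) (D : Set (Fin (r + 2) → F))
    (hD : ∀ w, w ∈ D ↔ Mom β N (spl w).1 (-((spl w).2.1 * a + (spl w).2.2 * b))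
      (-((spl w).2.1 * c + (spl w).2.2 * d))) :
    ((∃ w, w ∈ D ∧ w ≠ 0 ∧ hammingNorm w = N + 2) ∧
      ∀ w, w ∈ D → w ≠ 0 → N + 2 ≤ hammingNorm w) ∧
    {w | w ∈ D ∧ hammingNorm w = N + 2}.ncard = 2 * (NN F (N + 1) 1 * r) := by
  have hcount : {w | w ∈ D ∧ hammingNorm w = N + 2}.ncard = 2 * (NN F (N + 1) 1 * r) := by
    have h1 := WW_card hβ hr N a b c d hdet ha hb hc hd
    rw [hcard, Nat.add_sub_cancel] at h1
    rw [← h1]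
    have : {w | w ∈ D ∧ hammingNorm w = N + 2} = spl ⁻¹' (WW β N a b c d) := by
      ext w
      simp only [Set.mem_ofPred_eq, Set.mem_preimage, WW, hD, spl_norm]
    rw [this, Set.ncard_preimage_of_injective_subset_range spl_bij.1]
    rw [spl_bij.2.range_eq]; exact Set.subset_univ _
  refine ⟨⟨?_, ?_⟩, hcount⟩
  · have hpos : 0 < {w | w ∈ D ∧ hammingNorm w = N + 2}.ncard := by
      rw [hcount]
      have := NN_pos (F := F) (N + 1) (by omega) (by omega) 1 one_ne_zero
      have : 0 < r := by omega
      positivity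
    obtain ⟨w, hw⟩ := Set.nonempty_of_ncard_ne_zero hpos.ne'
    refine ⟨w, hw.1, ?_, hw.2⟩
    rintro rfl
    have := hw.2
    simp at this
  · intro w hw hne
    have h := weight_ge hβ N a b c d hdet _ _ _ ((hD w).1 hw) (by
      rintro ⟨h1, h2, h3⟩
      apply hne
      apply spl_bij.1
      rw [Prod.ext_iff, Prod.ext_iff]
      exact ⟨h1, h2, h3⟩)
    rw [spl_norm]
    rcases h with ⟨h1 | h1, h2⟩ | h
    · have e : w1 _ = 1 := if_pos h1; omega
    · have e : w1 _ = 1 := if_pos h1; omega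
    · omega

end final

end helpers

/-- all entries of M nonzero: minimum distance of the dual is k and weight-k count formula. -/
theorem stmt6 (p m q k : ℕ) (hp : p.Prime) (hm : 0 < m) (hq : q = p ^ m)
    (F : Type*) [Field F] [Fintype F] [DecidableEq F] (hF : Fintype.card F = q)
    (hrange : (p = 2 ∧ 4 ≤ k ∧ k ≤ q - 3) ∨ (Odd p ∧ 3 ≤ k ∧ k ≤ q - 2))
    (β : Fin (q - 1) → F) (hβinj : Function.Injective β)
    (hβrange : Set.range β = {x : F | x ≠ 0})
    (a : Matrix (Fin 2) (Fin 2) F) (ha : IsUnit a.det)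
    (G₁ : Matrix (Fin k) (Fin (q + 1)) F)
    (hGv : ∀ (i : Fin k) (j : Fin (q + 1)) (h : (j : ℕ) < q - 1),
      G₁ i j = β ⟨j, h⟩ ^ (i : ℕ))
    (hGc1 : ∀ (i : Fin k) (j : Fin (q + 1)), (j : ℕ) = q - 1 →
      G₁ i j = if (i : ℕ) = k - 2 then a 0 0 else if (i : ℕ) = k - 1 then a 1 0 else 0)
    (hGc2 : ∀ (i : Fin k) (j : Fin (q + 1)), (j : ℕ) = q →
      G₁ i j = if (i : ℕ) = k - 2 then a 0 1 else if (i : ℕ) = k - 1 then a 1 1 else 0)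
    (hA : a 0 0 * a 0 1 * a 1 0 * a 1 1 ≠ 0) :
    ((∃ c : Fin (q + 1) → F,
        (∀ y : Fin (q + 1) → F, (∃ x : Fin k → F, y = Matrix.vecMul x G₁) →
          ∑ i, c i * y i = 0) ∧ c ≠ 0 ∧ hammingNorm c = k) ∧
      (∀ c : Fin (q + 1) → F,
        (∀ y : Fin (q + 1) → F, (∃ x : Fin k → F, y = Matrix.vecMul x G₁) →
          ∑ i, c i * y i = 0) → c ≠ 0 → k ≤ hammingNorm c)) ∧
    (({c : Fin (q + 1) → F |
        (∀ y : Fin (q + 1) → F, (∃ x : Fin k → F, y = Matrix.vecMul x G₁) →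
          ∑ i, c i * y i = 0) ∧ hammingNorm c = k}.ncard : ℚ) =
      2 * ((q : ℚ) - 1) / q * ((q - 1).choose (k - 1) : ℚ) +
      (-1 : ℚ) ^ (k + (k - 1) / p) * (2 * ((q : ℚ) - 1) / q) *
        (((q / p - 1).choose ((k - 1) / p) : ℕ) : ℚ)) := by
  have hq4 : k + 2 ≤ q ∧ 3 ≤ k := by
    rcases hrange with h | h <;> omega
  obtain ⟨r, rfl⟩ : ∃ r, q = r + 1 := ⟨q - 1, by omega⟩
  obtain ⟨N, rfl⟩ : ∃ N, k = N + 2 := ⟨k - 2, by omega⟩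
  have hdet : a 0 0 * a 1 1 - a 0 1 * a 1 0 ≠ 0 := by
    rw [← Matrix.det_fin_two]; exact ha.ne_zero
  have ha00 : a 0 0 ≠ 0 := by intro h; simp [h] at hA
  have ha01 : a 0 1 ≠ 0 := by intro h; simp [h] at hA
  have ha10 : a 1 0 ≠ 0 := by intro h; simp [h] at hA
  have ha11 : a 1 1 ≠ 0 := by intro h; simp [h] at hA
  have hD : ∀ w : Fin (r + 2) → F,
      w ∈ {c : Fin (r + 2) → F | ∀ y : Fin (r + 1 + 1) → F,
        (∃ x : Fin (N + 2) → F, y = Matrix.vecMul x G₁) → ∑ i, c i * y i = 0} ↔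
      Mom (ι := Fin r) β N (spl w).1 (-((spl w).2.1 * a 0 0 + (spl w).2.2 * a 0 1))
      (-((spl w).2.1 * a 1 0 + (spl w).2.2 * a 1 1)) := by
    intro w
    have hrow : ∀ i : Fin (N + 2), ∑ j, w j * G₁ i j =
        ∑ x : Fin r, (spl w).1 x * β x ^ (i : ℕ)
        + (spl w).2.1 * (if (i : ℕ) = N then a 0 0 else if (i : ℕ) = N + 1 then a 1 0 else 0)
        + (spl w).2.2 * (if (i : ℕ) = N then a 0 1 else if (i : ℕ) = N + 1 then a 1 1 else 0) := by
      intro i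
      rw [Fin.sum_univ_castSucc, Fin.sum_univ_castSucc, hGc2 i (Fin.last _) (by simp),
        hGc1 i (Fin.last _).castSucc (by simp)]
      congr 2
      refine Finset.sum_congr rfl fun x _ => ?_
      rw [hGv i x.castSucc.castSucc (by simp)]
      rfl
    have h1 : w ∈ {c : Fin (r + 2) → F | ∀ y : Fin (r + 1 + 1) → F,
        (∃ x : Fin (N + 2) → F, y = Matrix.vecMul x G₁) → ∑ i, c i * y i = 0} ↔
        ∀ i : Fin (N + 2), ∑ j, w j * G₁ i j = 0 := by
      rw [Set.mem_ofPred_eq]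
      constructor
      · intro h i
        have := h _ ⟨Pi.single i 1, rfl⟩
        simpa using this
      · rintro h _ ⟨x, rfl⟩
        simp only [Matrix.vecMul, dotProduct, Finset.mul_sum]
        rw [Finset.sum_comm]
        refine Finset.sum_eq_zero fun i _ => ?_
        have := h i
        calc ∑ j, w j * (x i * G₁ i j) = x i * ∑ j, w j * G₁ i j := by
              rw [Finset.mul_sum]; exact Finset.sum_congr rfl fun j _ => by ring
          _ = 0 := by rw [this, mul_zero]
    rw [h1]
    constructor
    · intro h i hi
      have h2 := h ⟨i, hi⟩
      rw [hrow] at h2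
      simp only at h2
      split_ifs at h2 ⊢ <;> linear_combination h2
    · intro h i
      have h2 := h i i.2
      rw [hrow]
      split_ifs at h2 ⊢ <;> linear_combination h2
  have hc := core r N hF (by omega) β hβinj hβrange _ _ _ _ hdet ha00 ha01 ha10 ha11 _ hD
  refine ⟨hc.1, ?_⟩
  have hcount := hc.2
  have hform := NN_formula p m (N + 1) hp hm (hF.trans hq) (1 : F) one_ne_zero
  rw [← hq] at hform
  have hcq := congrArg (Nat.cast : ℕ → ℚ) hcount
  refine hcq.trans ?_
  have e1 : N + 2 - 1 = N + 1 := rfl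
  rw [e1, Nat.add_sub_cancel]
  rw [Nat.add_sub_cancel] at hform
  have hr0 : ((r + 1 : ℕ) : ℚ) ≠ 0 := by positivity
  have e2 : (-1 : ℚ) ^ (N + 2 + (N + 1) / p) = - (-1) ^ (N + 1 + (N + 1) / p) := by
    rw [show N + 2 + (N + 1) / p = (N + 1 + (N + 1) / p) + 1 by ring, pow_succ]; ring
  rw [e2]
  have e3 : ((r + 1 : ℕ) : ℚ) - 1 = r := by push_cast; ring
  rw [e3]
  apply mul_left_cancel₀ hr0
  field_simp
  push_cast at hform ⊢
  linear_combination (2 * (r : ℚ)) * hform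
end

section
/- Suppose (p = 2 and 4 ≤ k ≤ q−3) or (p odd and 3 ≤ k ≤ q−2), and suppose either (a_{11}a_{12}a_{21} ≠ 0 and a_{22} = 0) or (a_{11}a_{12}a_{22} ≠ 0 and a_{21} = 0). Then the minimum distance of RL_k^⊥(F_q^*, M) equals k, and the number of codewords of Hamming weight exactly k in RL_k^⊥(F_q^*, M) equals (2(q−1)/q)·C(q−1, k−1) + (−1)^{k−1+⌊(k−1)/p⌋}·((q−1)(q−2)/q)·C(q/p − 1, ⌊(k−1)/p⌋), where C(·,·) denotes the binomial coefficient. -/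
open Polynomial in
lemma rl_prod_char {F : Type*} [Field F] [Fintype F] [DecidableEq F] (p m q : ℕ) (hp : p.Prime)
    (hm : 0 < m) (hq : q = p ^ m) (hF : Fintype.card F = q) (ψ : AddChar F ℂ) (x₀ : F)
    (hx₀ : ψ x₀ ≠ 1) (t : ℂ) :
    ∏ x : F, (1 - ψ x * t) = (1 - t ^ p) ^ (q / p) := by
  classical
  have : Fact p.Prime := ⟨hp⟩
  have hch : CharP F p := charP_of_card_eq_prime_pow (hF.trans hq)
  have hpow : ∀ x, ψ x ^ p = 1 := by
    intro x
    rw [← AddChar.map_nsmul_eq_pow]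
    simp
  have hprim : IsPrimitiveRoot (ψ x₀) p := by
    rw [IsPrimitiveRoot.iff_orderOf]
    exact orderOf_eq_prime (hpow _) hx₀
  have hmaps : ∀ x ∈ (Finset.univ : Finset F), ψ x ∈ nthRootsFinset p (1 : ℂ) := by
    intro x _
    rw [mem_nthRootsFinset hp.pos]
    exact hpow x
  have hfib : ∀ ζ ∈ nthRootsFinset p (1 : ℂ),
      (Finset.univ.filter fun x => ψ x = ζ).card = (Finset.univ.filter fun x => ψ x = 1).card := by
    intro ζ hζ
    rw [mem_nthRootsFinset hp.pos] at hζ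
    obtain ⟨i, -, hi⟩ := hprim.eq_pow_of_pow_eq_one hζ
    rw [← AddChar.map_nsmul_eq_pow] at hi
    symm
    refine Finset.card_bij (fun x _ => x + i • x₀) ?_ ?_ ?_
    · intro x hx
      simp only [Finset.mem_filter, Finset.mem_univ, true_and] at hx ⊢
      rw [AddChar.map_add_eq_mul, hx, hi, one_mul]
    · intro x _ y _ h
      exact add_right_cancel h
    · intro y hy
      simp only [Finset.mem_filter, Finset.mem_univ, true_and] at hy
      refine ⟨y - i • x₀, ?_, by simp⟩
      simp only [Finset.mem_filter, Finset.mem_univ, true_and]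
      rw [AddChar.map_sub_eq_div, hy, hi, div_self]
      rintro rfl
      rw [zero_pow hp.ne_zero] at hζ
      exact zero_ne_one hζ
  have hcard : q = p * (Finset.univ.filter fun x => ψ x = 1).card := by
    rw [← hF, ← Finset.card_univ, Finset.card_eq_sum_card_fiberwise hmaps, Finset.sum_congr rfl hfib,
      Finset.sum_const, hprim.card_nthRootsFinset, smul_eq_mul]
  rw [← Finset.prod_fiberwise_of_maps_to hmaps]
  have h1 : ∀ ζ ∈ nthRootsFinset p (1 : ℂ), ∏ x with ψ x = ζ, (1 - ψ x * t) =
      (1 - ζ * t) ^ (Finset.univ.filter fun x => ψ x = 1).card := by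
    intro ζ hζ
    rw [← hfib ζ hζ]
    apply Finset.prod_eq_pow_card
    intro x hx
    rw [(Finset.mem_filter.1 hx).2]
  rw [Finset.prod_congr rfl h1, Finset.prod_pow, ← hprim.pow_sub_pow_eq_prod_sub_mul _ _ hp.pos,
    one_pow]
  congr 1
  exact (Nat.div_eq_of_eq_mul_right hp.pos hcard).symm

open Polynomial in
lemma rl_coeff (p n j : ℕ) (hp : 0 < p) :
    ((1 - X ^ p : ℂ[X]) ^ n * ∑ i ∈ Finset.range p, X ^ i).coeff j =
      (-1) ^ (j / p) * (n.choose (j / p) : ℂ) := by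
  have h0 : ((1 - X ^ p : ℂ[X]) ^ n) = expand ℂ p ((1 - X) ^ n) := by simp
  have h2 : ∀ r, ((1 - X : ℂ[X]) ^ n).coeff r = (-1) ^ r * (n.choose r : ℂ) := by
    intro r
    have : (1 - X : ℂ[X]) = (1 + X).comp (C (-1) * X) := by simp [sub_eq_add_neg]
    rw [this, ← pow_comp, comp_C_mul_X_coeff, coeff_one_add_X_pow, mul_comm]
  rw [h0, Finset.mul_sum, finsetSum_coeff]
  simp_rw [coeff_mul_X_pow']
  rw [Finset.sum_eq_single (j % p)]
  · rw [if_pos (Nat.mod_le _ _), coeff_expand hp, if_pos (Nat.dvd_sub_mod j), h2]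
    have : (j - j % p) / p = j / p := by
      rw [show j - j % p = p * (j / p) by have := Nat.div_add_mod j p; omega]
      exact Nat.mul_div_cancel_left _ hp
    rw [this]
  · intro i hi hne
    split_ifs with hij
    · rw [coeff_expand hp, if_neg]
      intro hd
      apply hne
      have h1 := (Nat.modEq_iff_dvd' hij).2 hd
      rw [← Nat.mod_eq_of_lt (Finset.mem_range.1 hi)]
      exact h1
    · rfl
  · intro h
    exact absurd (Finset.mem_range.2 (Nat.mod_lt _ hp)) h

/-- number of `j`-subsets of the nonzero elements with sum `b` -/
def rlN (F : Type*) [Field F] [Fintype F] [DecidableEq F] (j : ℕ) (b : F) : ℕ :=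
  ((Finset.powersetCard j (Finset.univ : Finset Fˣ)).filter fun S : Finset Fˣ => ∑ x ∈ S, (x : F) = b).card

open Polynomial in
lemma rl_charsum {F : Type*} [Field F] [Fintype F] [DecidableEq F] (p m q : ℕ) (hp : p.Prime)
    (hm : 0 < m) (hq : q = p ^ m) (hF : Fintype.card F = q) (ψ : AddChar F ℂ) (x₀ : F)
    (hx₀ : ψ x₀ ≠ 1) (j : ℕ) :
    ∑ S ∈ Finset.powersetCard j (Finset.univ : Finset Fˣ), ψ (∑ x ∈ S, (x : F)) =
      (-1) ^ (j + j / p) * ((q / p - 1).choose (j / p) : ℂ) := by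
  have hpos : 0 < q / p := by
    apply Nat.div_pos _ hp.pos
    rw [hq]
    exact Nat.le_self_pow hm.ne' p
  have key : ∏ x : Fˣ, (1 + (- C (ψ x)) * X : ℂ[X]) =
      (1 - X ^ p : ℂ[X]) ^ (q / p - 1) * ∑ i ∈ Finset.range p, X ^ i := by
    have h1 : (1 - X : ℂ[X]) ≠ 0 := by
      intro h
      have := congrArg (eval 0) h
      simp at this
    apply mul_left_cancel₀ h1
    have h2 : (1 - X : ℂ[X]) * ∑ i ∈ Finset.range p, X ^ i = 1 - X ^ p := by
      have := mul_geom_sum (X : ℂ[X]) p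
      linear_combination -this
    rw [mul_left_comm, h2, ← pow_succ, Nat.sub_add_cancel hpos]
    apply Polynomial.funext
    intro t
    have h3 := rl_prod_char p m q hp hm hq hF ψ x₀ hx₀ t
    rw [← Fintype.prod_subtype_mul_prod_subtype (fun x : F => x = 0)] at h3
    simp only [eval_mul, eval_sub, eval_one, eval_X, eval_prod, eval_add, eval_neg, eval_C,
      eval_pow]
    rw [← h3]
    congr 1
    · have : ∀ i : {x : F // x = 0}, 1 - ψ (i : F) * t = 1 - t := by
        intro i
        rw [i.2]
        simp
      simp [this]
    · apply Fintype.prod_equiv unitsEquivNeZero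
      intro x
      simp [sub_eq_add_neg]
  have h4 := congrArg (fun P => coeff P j) key
  simp only [rl_coeff p _ j hp.pos] at h4
  rw [Finset.prod_one_add, finsetSum_coeff] at h4
  have h5 : ∀ S : Finset Fˣ, (∏ x ∈ S, (- C (ψ x) * X : ℂ[X])).coeff j =
      if S.card = j then (-1) ^ j * ψ (∑ x ∈ S, (x : F)) else 0 := by
    intro S
    have h7 : ψ (∑ x ∈ S, (x : F)) = ∏ x ∈ S, ψ (x : F) := by
      induction S using Finset.induction_on with
      | empty => simp
      | insert a s ha ih =>
        rw [Finset.sum_insert ha, Finset.prod_insert ha, AddChar.map_add_eq_mul, ih]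
    have h6 : (∏ x ∈ S, (- C (ψ x) * X : ℂ[X])) =
        C ((-1) ^ S.card * ψ (∑ x ∈ S, (x : F))) * X ^ S.card := by
      rw [Finset.prod_mul_distrib, Finset.prod_const, Finset.prod_neg, ← map_prod,
        ← h7]
      simp
    rw [h6, coeff_C_mul, coeff_X_pow]
    by_cases h : S.card = j
    · simp [h]
    · simp [h, Ne.symm h]
  simp_rw [h5] at h4
  rw [← Finset.sum_filter, ← Finset.powersetCard_eq_filter, ← Finset.mul_sum] at h4
  rw [pow_add, mul_assoc, ← h4, ← mul_assoc, ← mul_pow]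
  simp

lemma rl_scale {F : Type*} [Field F] [Fintype F] [DecidableEq F] (j : ℕ) (b : F) (hb : b ≠ 0) :
    rlN F j b = rlN F j 1 := by
  symm
  have : ∀ S : Finset Fˣ, ∑ x ∈ (S.map (Equiv.mulLeft (Units.mk0 b hb)).toEmbedding : Finset Fˣ), (x : F) =
      b * ∑ x ∈ S, (x : F) := by
    intro S
    rw [Finset.sum_map, Finset.mul_sum]
    simp
  refine Finset.card_bij (fun S _ => S.map (Equiv.mulLeft (Units.mk0 b hb)).toEmbedding) ?_ ?_ ?_
  · intro S hS
    simp only [Finset.mem_filter, Finset.mem_powersetCard, Finset.subset_univ, true_and] at hS ⊢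
    rw [this, hS.2, Finset.card_map]
    simpa using hS.1
  · intro S _ T _ h
    exact Finset.map_injective _ h
  · intro T hT
    simp only [Finset.mem_filter, Finset.mem_powersetCard, Finset.subset_univ, true_and] at hT
    obtain ⟨S, rfl⟩ : ∃ S : Finset Fˣ, S.map (Equiv.mulLeft (Units.mk0 b hb)).toEmbedding = T :=
      ⟨T.map (Equiv.mulLeft (Units.mk0 b hb)).symm.toEmbedding, by
        rw [Finset.map_map]; ext; simp⟩
    refine ⟨S, ?_, rfl⟩
    rw [this, Finset.card_map] at hT
    simp only [Finset.mem_filter, Finset.mem_powersetCard, Finset.subset_univ, true_and]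
    exact ⟨hT.1, mul_left_cancel₀ hb (by rw [hT.2, mul_one])⟩

lemma rl_diff {F : Type*} [Field F] [Fintype F] [DecidableEq F] (p m q : ℕ) (hp : p.Prime)
    (hm : 0 < m) (hq : q = p ^ m) (hF : Fintype.card F = q) (j : ℕ) :
    (rlN F j 0 : ℚ) - rlN F j 1 = (-1) ^ (j + j / p) * ((q / p - 1).choose (j / p) : ℚ) := by
  obtain ⟨ψ, hψ⟩ := (AddChar.exists_apply_ne_zero (a := (1 : F))).2 one_ne_zero
  have h := rl_charsum p m q hp hm hq hF ψ 1 hψ j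
  have hne : ψ ≠ 1 := by
    rintro rfl
    simp at hψ
  have h0 := AddChar.sum_eq_zero_of_ne_one hne
  rw [← Finset.sum_fiberwise_of_maps_to (t := Finset.univ) (g := fun S : Finset Fˣ => ∑ x ∈ S, (x : F))
    (fun _ _ => Finset.mem_univ _)] at h
  have h1 : ∀ b : F, ∑ S ∈ (Finset.powersetCard j (Finset.univ : Finset Fˣ)).filter
      (fun S : Finset Fˣ => ∑ x ∈ S, (x : F) = b), ψ (∑ x ∈ S, (x : F)) = rlN F j b * ψ b := by
    intro b
    rw [rlN, ← nsmul_eq_mul]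
    apply Finset.sum_eq_card_nsmul
    intro S hS
    rw [(Finset.mem_filter.1 hS).2]
  simp_rw [h1] at h
  rw [← Finset.add_sum_erase _ _ (Finset.mem_univ (0 : F))] at h h0
  have h2 : ∀ b ∈ Finset.univ.erase (0 : F), (rlN F j b : ℂ) * ψ b = rlN F j 1 * ψ b := by
    intro b hb
    rw [rl_scale j b (Finset.ne_of_mem_erase hb)]
  rw [Finset.sum_congr rfl h2, ← Finset.mul_sum] at h
  rw [AddChar.map_zero_eq_one] at h h0
  have h3 : (rlN F j 0 : ℂ) - rlN F j 1 = (-1) ^ (j + j / p) * ((q / p - 1).choose (j / p) : ℂ) := by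
    rw [← h]
    linear_combination (-(rlN F j 1 : ℂ)) * h0
  exact_mod_cast h3

lemma rl_total {F : Type*} [Field F] [Fintype F] [DecidableEq F] (q : ℕ)
    (hF : Fintype.card F = q) (j : ℕ) :
    (rlN F j 0 : ℚ) + (q - 1) * rlN F j 1 = ((q - 1).choose j : ℚ) := by
  have hq : 1 ≤ q := by rw [← hF]; exact Fintype.card_pos
  have h : (q - 1).choose j = ∑ b : F, rlN F j b := by
    unfold rlN
    rw [← Finset.card_eq_sum_card_fiberwise (fun _ _ => Finset.mem_univ _),
      Finset.card_powersetCard, Finset.card_univ, Fintype.card_units, hF]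
  rw [h, ← Finset.add_sum_erase _ _ (Finset.mem_univ (0 : F)),
    Finset.sum_congr rfl (fun b hb => rl_scale j b (Finset.ne_of_mem_erase hb)),
    Finset.sum_const, Finset.card_erase_of_mem (Finset.mem_univ _), Finset.card_univ, hF]
  push_cast [Nat.cast_sub hq]
  simp [Nat.cast_sub hq]

lemma rl_count {F : Type*} [Field F] [Fintype F] [DecidableEq F] (p m q : ℕ) (hp : p.Prime)
    (hm : 0 < m) (hq : q = p ^ m) (hF : Fintype.card F = q) (j : ℕ) (b : F) (hb : b ≠ 0) :
    ((q : ℚ) - 1) * (rlN F j 0 + rlN F j b) = 2 * ((q : ℚ) - 1) / q * ((q - 1).choose j : ℚ) +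
      (-1 : ℚ) ^ (j + j / p) * (((q : ℚ) - 1) * ((q : ℚ) - 2) / q) *
        (((q / p - 1).choose (j / p) : ℕ) : ℚ) := by
  have hq0 : (q : ℚ) ≠ 0 := by
    rw [← hF]
    exact_mod_cast Fintype.card_ne_zero
  have h1 := rl_diff p m q hp hm hq hF j
  have h2 := rl_total q hF j
  rw [rl_scale j b hb, ← h2]
  have h3 : (-1 : ℚ) ^ (j + j / p) * (((q : ℚ) - 1) * ((q : ℚ) - 2) / q) *
        (((q / p - 1).choose (j / p) : ℕ) : ℚ) =
      ((rlN F j 0 : ℚ) - rlN F j 1) * (((q : ℚ) - 1) * ((q : ℚ) - 2) / q) := by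
    rw [h1]; ring
  rw [h3]
  field_simp
  ring

lemma rl_exists {F : Type*} [Field F] [Fintype F] [DecidableEq F] (q : ℕ)
    (hF : Fintype.card F = q) (j : ℕ) (hj1 : 1 ≤ j) (hj2 : j + 2 ≤ q) (b : F) (hb : b ≠ 0) :
    0 < rlN F j b := by
  rw [rl_scale j b hb]
  have hcu : (Finset.univ : Finset Fˣ).card = q - 1 := by
    rw [Finset.card_univ, Fintype.card_units, hF]
  have key : ∀ S : Finset Fˣ, S.card = j → ∑ x ∈ S, (x : F) ≠ 0 → 0 < rlN F j 1 := by
    intro S hS h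
    rw [← rl_scale j _ h]
    apply Finset.card_pos.2
    exact ⟨S, by simp [hS]⟩
  obtain ⟨T, -, hT⟩ := Finset.exists_subset_card_eq
    (s := (Finset.univ : Finset Fˣ)) (n := j + 1) (by omega)
  obtain ⟨x, hx, y, hy, hxy⟩ := Finset.one_lt_card.1 (show 1 < T.card by omega)
  by_cases h : ∑ z ∈ T.erase x, (z : F) = 0
  · refine key (T.erase y) (by rw [Finset.card_erase_of_mem hy]; omega) ?_
    intro h'
    have h1 := Finset.add_sum_erase T (fun z : Fˣ => (z : F)) hx
    have h2 := Finset.add_sum_erase T (fun z : Fˣ => (z : F)) hy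
    rw [h] at h1
    rw [h', ← h1] at h2
    apply hxy
    ext
    simpa using h2.symm
  · exact key (T.erase x) (by rw [Finset.card_erase_of_mem hx]; omega) h
open Polynomial in
/-- parity check condition in polynomial form -/
def rlD {F : Type*} [Field F] [Fintype F] [DecidableEq F] (k : ℕ) (A B : F) (f : Fˣ → F) : Prop :=
  ∀ g : F[X], g.natDegree < k →
    ∑ x : Fˣ, f x * g.eval (x : F) + g.coeff (k - 2) * A + g.coeff (k - 1) * B = 0

/-- support -/
def rlS {F : Type*} [Field F] [Fintype F] [DecidableEq F] (f : Fˣ → F) : Finset Fˣ :=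
  Finset.univ.filter fun x => f x ≠ 0

/-- the codeword part attached to a support and a constant -/
noncomputable def rlf {F : Type*} [Field F] [Fintype F] [DecidableEq F] (S : Finset Fˣ) (A : F) :
    Fˣ → F :=
  fun x => if x ∈ S then -A * Lagrange.nodalWeight S (fun y : Fˣ => (y : F)) x else 0

section
variable {F : Type*} [Field F] [Fintype F] [DecidableEq F]

lemma rl_inj (S : Finset Fˣ) : Set.InjOn (fun y : Fˣ => (y : F)) S :=
  fun _ _ _ _ h => Units.ext h

open Polynomial Lagrange in
lemma rl_erase (k : ℕ) (A B : F) (f : Fˣ → F) (h : rlD k A B f) (x : Fˣ) (hx : x ∈ rlS f)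
    (hk : (rlS f).card ≤ k) :
    f x * (nodal ((rlS f).erase x) (fun y : Fˣ => (y : F))).eval (x : F) +
      (nodal ((rlS f).erase x) (fun y : Fˣ => (y : F))).coeff (k - 2) * A +
      (nodal ((rlS f).erase x) (fun y : Fˣ => (y : F))).coeff (k - 1) * B = 0 := by
  have hpos : 0 < (rlS f).card := Finset.card_pos.2 ⟨x, hx⟩
  have h1 := h (nodal ((rlS f).erase x) (fun y : Fˣ => (y : F))) (by
    rw [natDegree_nodal, Finset.card_erase_of_mem hx]; omega)
  rw [Finset.sum_eq_single x] at h1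
  · exact h1
  · intro y _ hy
    by_cases hf : f y = 0
    · rw [hf, zero_mul]
    · have : y ∈ (rlS f).erase x := Finset.mem_erase.2 ⟨hy, by simp [rlS, hf]⟩
      have h2 := eval_nodal_at_node (v := fun y : Fˣ => (y : F)) this
      rw [h2, mul_zero]
  · simp

open Polynomial Lagrange in
lemma rl_eval_ne (S : Finset Fˣ) (x : Fˣ) :
    (nodal (S.erase x) (fun y : Fˣ => (y : F))).eval (x : F) ≠ 0 := by
  apply eval_nodal_not_at_node
  intro i hi h
  exact (Finset.ne_of_mem_erase hi) (Units.ext h.symm)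

open Polynomial Lagrange in
lemma rl_card_ge (k : ℕ) (A B : F) (f : Fˣ → F) (h : rlD k A B f) (hf : (rlS f).Nonempty) :
    k - 1 ≤ (rlS f).card := by
  obtain ⟨x, hx⟩ := hf
  by_contra hlt
  push Not at hlt
  have hpos : 0 < (rlS f).card := Finset.card_pos.2 ⟨x, hx⟩
  have h1 := rl_erase k A B f h x hx (by omega)
  rw [coeff_eq_zero_of_natDegree_lt (n := k - 2), coeff_eq_zero_of_natDegree_lt (n := k - 1)] at h1
  · simp only [zero_mul, add_zero, mul_eq_zero] at h1
    rcases h1 with h1 | h1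
    · simp [rlS, h1] at hx
    · exact rl_eval_ne _ _ h1
  · rw [natDegree_nodal, Finset.card_erase_of_mem hx]; omega
  · rw [natDegree_nodal, Finset.card_erase_of_mem hx]; omega

open Polynomial Lagrange in
lemma rl_card_gt (k : ℕ) (f : Fˣ → F) (h : rlD k 0 0 f) (hf : (rlS f).Nonempty) :
    k < (rlS f).card := by
  obtain ⟨x, hx⟩ := hf
  by_contra hlt
  push Not at hlt
  have h1 := rl_erase k 0 0 f h x hx (by omega)
  simp only [mul_zero, add_zero, mul_eq_zero] at h1
  rcases h1 with h1 | h1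
  · simp [rlS, h1] at hx
  · exact rl_eval_ne _ _ h1

open Polynomial Lagrange in
lemma rl_empty (k : ℕ) (hk : 2 ≤ k) (A B : F) (f : Fˣ → F) (h : rlD k A B f) (hf : rlS f = ∅) :
    A = 0 ∧ B = 0 := by
  have hf0 : ∀ x, f x = 0 := by
    intro x
    by_contra hx
    have : x ∈ rlS f := by simp [rlS, hx]
    rw [hf] at this
    simp at this
  constructor
  · have := h (X ^ (k - 2)) (by rw [natDegree_X_pow]; omega)
    simpa [hf0, coeff_X_pow, show k - 1 ≠ k - 2 by omega] using this
  · have := h (X ^ (k - 1)) (by rw [natDegree_X_pow]; omega)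
    simpa [hf0, coeff_X_pow, show k - 2 ≠ k - 1 by omega] using this

open Polynomial Lagrange in
lemma rl_nodal_coeff (S : Finset Fˣ) (k : ℕ) (hk : 2 ≤ k) (hS : S.card = k - 1) :
    (nodal S (fun y : Fˣ => (y : F))).coeff (k - 2) = - ∑ x ∈ S, (x : F) ∧
    (nodal S (fun y : Fˣ => (y : F))).coeff (k - 1) = 1 := by
  constructor
  · have := prod_X_sub_C_coeff_card_pred S (fun y : Fˣ => (y : F)) (by omega)
    rw [hS] at this
    exact this
  · have := nodal_monic (s := S) (v := fun y : Fˣ => (y : F))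
    rw [Monic, leadingCoeff, natDegree_nodal, hS] at this
    exact this

open Polynomial Lagrange in
lemma rl_char (k : ℕ) (hk : 2 ≤ k) (A B : F) (f : Fˣ → F) (h : rlD k A B f)
    (hf : (rlS f).card = k - 1) : f = rlf (rlS f) A ∧ B = A * ∑ x ∈ rlS f, (x : F) := by
  constructor
  · funext x
    by_cases hx : x ∈ rlS f
    · have h1 := rl_erase k A B f h x hx (by omega)
      have hc : ((rlS f).erase x).card = k - 2 := by
        rw [Finset.card_erase_of_mem hx]; omega
      have h2 : (nodal ((rlS f).erase x) (fun y : Fˣ => (y : F))).coeff (k - 2) = 1 := by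
        have := nodal_monic (s := (rlS f).erase x) (v := fun y : Fˣ => (y : F))
        rw [Monic, leadingCoeff, natDegree_nodal, hc] at this
        exact this
      rw [h2, coeff_eq_zero_of_natDegree_lt (n := k - 1) (by rw [natDegree_nodal, hc]; omega)] at h1
      rw [rlf, if_pos hx, nodalWeight_eq_eval_nodal_erase_inv, eq_mul_inv_iff_mul_eq₀
        (rl_eval_ne _ _)]
      linear_combination h1
    · rw [rlf, if_neg hx]
      simpa [rlS] using hx
  · have h1 := h (nodal (rlS f) (fun y : Fˣ => (y : F))) (by rw [natDegree_nodal]; omega)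
    obtain ⟨h2, h3⟩ := rl_nodal_coeff (rlS f) k hk hf
    rw [h2, h3, Finset.sum_eq_zero] at h1
    · linear_combination h1
    · intro y _
      by_cases hy : f y = 0
      · rw [hy, zero_mul]
      · have : y ∈ rlS f := by simp [rlS, hy]
        have h2 := eval_nodal_at_node (v := fun y : Fˣ => (y : F)) this
        rw [h2, mul_zero]

open Polynomial Lagrange in
lemma rl_conv (k : ℕ) (hk : 2 ≤ k) (A B : F) (S : Finset Fˣ) (hS : S.card = k - 1)
    (hB : B = A * ∑ x ∈ S, (x : F)) : rlD k A B (rlf S A) := by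
  intro g hg
  obtain ⟨h2, h3⟩ := rl_nodal_coeff S k hk hS
  set P := nodal S (fun y : Fˣ => (y : F)) with hP
  set r := g - C (g.coeff (k - 1)) * P with hr
  have hrdeg : r.degree < (S.card : ℕ) := by
    rw [hS, degree_lt_iff_coeff_zero]
    intro i hi
    rcases Nat.eq_or_lt_of_le hi with hi | hi
    · rw [← hi, hr, coeff_sub, coeff_C_mul, h3]
      ring
    · rw [hr, coeff_sub, coeff_C_mul, coeff_eq_zero_of_natDegree_lt (n := i) (p := g) (by omega),
        coeff_eq_zero_of_natDegree_lt (n := i) (p := P) (by rw [hP, natDegree_nodal]; omega)]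
      ring
  have h4 := coeff_eq_sum (rl_inj S) hrdeg
  rw [hS, show k - 1 - 1 = k - 2 by omega] at h4
  have h5 : ∑ x : Fˣ, rlf S A x * g.eval (x : F) = -A * r.coeff (k - 2) := by
    rw [h4, Finset.mul_sum]
    simp only [rlf, ite_mul, zero_mul]
    rw [Finset.sum_ite_mem, Finset.univ_inter]
    apply Finset.sum_congr rfl
    intro x hx
    have h6 : r.eval (x : F) = g.eval (x : F) := by
      have h2 := eval_nodal_at_node (v := fun y : Fˣ => (y : F)) hx
      rw [hr, eval_sub, eval_mul, hP, h2]
      ring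
    rw [h6, nodalWeight, Finset.prod_inv_distrib, div_eq_mul_inv]
    ring
  rw [h5, hr, coeff_sub, coeff_C_mul, h2, hB]
  ring

lemma rl_supp (S : Finset Fˣ) (A : F) (hA : A ≠ 0) : rlS (rlf S A) = S := by
  ext x
  simp only [rlS, Finset.mem_filter, Finset.mem_univ, true_and, rlf]
  by_cases hx : x ∈ S
  · simp [hx, hA, Lagrange.nodalWeight_ne_zero (rl_inj S) hx]
  · simp [hx]

/-- dual code on the index set of nonzero elements plus two extra points -/
def rlCode (k : ℕ) (r s : Bool → F) (w : Fˣ ⊕ Bool → F) : Prop :=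
  rlD k (∑ t, r t * w (Sum.inr t)) (∑ t, s t * w (Sum.inr t)) (fun x => w (Sum.inl x))

lemma rl_norm (w : Fˣ ⊕ Bool → F) : hammingNorm w =
    (rlS (fun x => w (Sum.inl x))).card + hammingNorm (fun t => w (Sum.inr t)) := by
  unfold hammingNorm rlS
  rw [← Finset.card_map (Function.Embedding.inl : Fˣ ↪ Fˣ ⊕ Bool),
    ← Finset.card_map (Function.Embedding.inr : Bool ↪ Fˣ ⊕ Bool), ← Finset.card_union_of_disjoint]
  · congr 1
    ext z
    cases z <;> simp
  · rw [Finset.disjoint_left]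
    intro z
    cases z <;> simp

lemma rl_mindist (k : ℕ) (hk : 2 ≤ k) (r s : Bool → F)
    (hdet : r false * s true - r true * s false ≠ 0) (w : Fˣ ⊕ Bool → F) (hw : rlCode k r s w)
    (hw0 : w ≠ 0) :
    (k ≤ hammingNorm w) ∧ (hammingNorm w = k → (rlS (fun x => w (Sum.inl x))).card = k - 1 ∧
      hammingNorm (fun t => w (Sum.inr t)) = 1) := by
  rw [rl_norm]
  unfold rlCode at hw
  rcases Finset.eq_empty_or_nonempty (rlS (fun x => w (Sum.inl x))) with he | hne
  · exfalso
    obtain ⟨h1, h2⟩ := rl_empty k hk _ _ _ hw he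
    rw [Fintype.sum_bool] at h1 h2
    apply hw0
    funext z
    rcases z with x | t
    · by_contra hx
      have : x ∈ rlS (fun x => w (Sum.inl x)) := by simpa [rlS] using hx
      rw [he] at this
      simp at this
    · cases t
      · apply mul_left_cancel₀ hdet
        simp only [Pi.zero_apply]
        linear_combination s true * h1 - r true * h2
      · apply mul_left_cancel₀ hdet
        simp only [Pi.zero_apply]
        linear_combination r false * h2 - s false * h1
  · have h1 := rl_card_ge k _ _ _ hw hne
    rcases Nat.eq_zero_or_pos (hammingNorm (fun t => w (Sum.inr t))) with h0 | h0
    · have h2 : ∀ t, w (Sum.inr t) = 0 := fun t => congrFun (hammingNorm_eq_zero.1 h0) t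
      simp only [h2, mul_zero, Finset.sum_const_zero] at hw
      have := rl_card_gt k _ hw hne
      omega
    · omega

/-- explicit minimum weight words -/
noncomputable def rlW (r : Bool → F) (z : Bool × Finset Fˣ × Fˣ) : Fˣ ⊕ Bool → F :=
  Sum.elim (rlf z.2.1 (r z.1 * z.2.2)) (Pi.single z.1 (z.2.2 : F))

/-- parameters of minimum weight words -/
def rlT (k : ℕ) (r s : Bool → F) : Finset (Bool × Finset Fˣ × Fˣ) :=
  Finset.univ.filter fun z => z.2.1.card = k - 1 ∧ s z.1 = r z.1 * ∑ x ∈ z.2.1, (x : F)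

lemma rl_single (r : Bool → F) (t : Bool) (u : F) :
    ∑ t', r t' * (Pi.single t u : Bool → F) t' = r t * u := by
  cases t <;> simp [Fintype.sum_bool, Pi.single_apply]

lemma rl_W_mem (k : ℕ) (hk : 2 ≤ k) (r s : Bool → F) (hr : ∀ t, r t ≠ 0)
    (z : Bool × Finset Fˣ × Fˣ) (hz : z ∈ rlT k r s) :
    rlCode k r s (rlW r z) ∧ hammingNorm (rlW r z) = k := by
  obtain ⟨t, S, u⟩ := z
  simp only [rlT, Finset.mem_filter, Finset.mem_univ, true_and] at hz
  constructor
  · unfold rlCode rlW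
    simp only [Sum.elim_inr, Sum.elim_inl, rl_single]
    apply rl_conv k hk _ _ _ hz.1
    rw [hz.2]
    ring
  · rw [rl_norm]
    unfold rlW
    simp only [Sum.elim_inr, Sum.elim_inl]
    have h1 : rlS (fun x => rlf S (r t * u) x) = S := rl_supp _ _ (mul_ne_zero (hr t) u.ne_zero)
    have h2 : hammingNorm (fun t' => (Pi.single t (u : F) : Bool → F) t') = 1 := by
      unfold hammingNorm
      rw [Finset.card_eq_one]
      refine ⟨t, ?_⟩
      ext t'
      by_cases h : t' = t <;> simp [h]
    rw [h1, h2, hz.1]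
    omega

lemma rl_set (k : ℕ) (hk : 2 ≤ k) (r s : Bool → F) (hr : ∀ t, r t ≠ 0)
    (hdet : r false * s true - r true * s false ≠ 0) :
    {w : Fˣ ⊕ Bool → F | rlCode k r s w ∧ hammingNorm w = k} = rlW r '' (rlT k r s) := by
  ext w
  constructor
  · rintro ⟨hw, hwk⟩
    have hw0 : w ≠ 0 := by
      rintro rfl
      rw [hammingNorm_zero] at hwk
      omega
    obtain ⟨h1, h2⟩ := (rl_mindist k hk r s hdet w hw hw0).2 hwk
    unfold hammingNorm at h2
    obtain ⟨t, ht⟩ := Finset.card_eq_one.1 h2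
    have ht' : ∀ t', w (Sum.inr t') ≠ 0 ↔ t' = t := by
      intro t'
      have := Finset.ext_iff.1 ht t'
      simpa using this
    have hu : w (Sum.inr t) ≠ 0 := (ht' t).2 rfl
    have hs : (fun t' => w (Sum.inr t')) = Pi.single t (w (Sum.inr t)) := by
      funext t'
      by_cases h : t' = t
      · subst h; simp
      · rw [Pi.single_eq_of_ne h]
        by_contra h'
        exact h ((ht' t').1 h')
    have hs' : ∀ r : Bool → F, ∑ t', r t' * w (Sum.inr t') = r t * w (Sum.inr t) := by
      intro r
      rw [← rl_single r t, ← hs]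
    unfold rlCode at hw
    rw [hs', hs'] at hw
    obtain ⟨h3, h4⟩ := rl_char k hk _ _ _ hw h1
    refine ⟨(t, rlS (fun x => w (Sum.inl x)), Units.mk0 _ hu), ?_, ?_⟩
    · simp only [rlT, Finset.coe_filter, Finset.mem_univ, true_and, Set.mem_ofPred_eq]
      refine ⟨h1, ?_⟩
      apply mul_right_cancel₀ hu
      rw [h4]; ring
    · unfold rlW
      funext z
      rcases z with x | t'
      · simp only [Sum.elim_inl, Units.val_mk0]
        exact (congrFun h3 x).symm
      · simp only [Sum.elim_inr, Units.val_mk0]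
        exact (congrFun hs t').symm
  · rintro ⟨z, hz, rfl⟩
    exact rl_W_mem k hk r s hr z hz

lemma rl_W_inj (r : Bool → F) (hr : ∀ t, r t ≠ 0) : Function.Injective (rlW r) := by
  rintro ⟨t, S, u⟩ ⟨t', S', u'⟩ h
  unfold rlW at h
  have h1 : rlf S (r t * u) = rlf S' (r t' * u') := by
    funext x
    exact congrFun h (Sum.inl x)
  have h2 : (Pi.single t (u : F) : Bool → F) = Pi.single t' (u' : F) := by
    funext x
    exact congrFun h (Sum.inr x)
  have h3 : S = S' := by
    rw [← rl_supp S _ (mul_ne_zero (hr t) u.ne_zero), h1,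
      rl_supp S' _ (mul_ne_zero (hr t') u'.ne_zero)]
  have h4 : t = t' := by
    by_contra hne
    have := congrFun h2 t
    rw [Pi.single_eq_same, Pi.single_eq_of_ne hne] at this
    exact u.ne_zero this
  subst h4 h3
  have h5 := Pi.single_injective t h2
  rw [Units.ext h5]

lemma rl_T_card (q k : ℕ) (hF : Fintype.card F = q) (r s : Bool → F) (hr : ∀ t, r t ≠ 0) :
    (rlT k r s).card = (q - 1) * (rlN F (k - 1) (s false / r false) +
      rlN F (k - 1) (s true / r true)) := by
  have h1 : ∀ t : Bool, ((rlT k r s).filter fun z => z.1 = t).card =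
      rlN F (k - 1) (s t / r t) * (q - 1) := by
    intro t
    have h2 : (Finset.univ : Finset Fˣ).card = q - 1 := by
      rw [Finset.card_univ, Fintype.card_units, hF]
    rw [rlN, ← h2, ← Finset.card_product]
    refine Finset.card_bij (fun z _ => z.2) ?_ ?_ ?_
    · rintro ⟨t', S, u⟩ hz
      simp only [rlT, Finset.mem_filter, Finset.mem_univ, true_and] at hz
      obtain ⟨⟨h1, h2⟩, rfl⟩ := hz
      simp only [Finset.mem_filter, Finset.mem_univ, Finset.mem_product, Finset.mem_powersetCard,
        Finset.subset_univ, true_and, and_true]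
      refine ⟨h1, ?_⟩
      rw [h2, mul_div_cancel_left₀ _ (hr t')]
    · rintro ⟨t', y⟩ h ⟨t'', y'⟩ h' hy
      rw [Finset.mem_filter] at h h'
      exact Prod.ext (h.2.trans h'.2.symm) hy
    · rintro ⟨S, u⟩ hz
      simp only [Finset.mem_filter, Finset.mem_univ, Finset.mem_product, Finset.mem_powersetCard,
        Finset.subset_univ, true_and, and_true] at hz
      refine ⟨(t, S, u), ?_, rfl⟩
      simp only [rlT, Finset.mem_filter, Finset.mem_univ, true_and, and_true]
      refine ⟨hz.1, ?_⟩
      rw [hz.2, mul_div_cancel₀ _ (hr t)]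
  rw [Finset.card_eq_sum_card_fiberwise (f := Prod.fst) (t := Finset.univ)
    (fun _ _ => Finset.mem_univ _), Fintype.sum_bool, h1, h1]
  ring

end
open Polynomial in
lemma rl_transfer {F : Type*} [Field F] [Fintype F] [DecidableEq F] (q k : ℕ)
    (hk : 2 ≤ k) (a : Matrix (Fin 2) (Fin 2) F)
    (G₁ : Matrix (Fin k) (Fin (q + 1)) F) (E : Fˣ ⊕ Bool ≃ Fin (q + 1))
    (h1 : ∀ i x, G₁ i (E (Sum.inl x)) = (x : F) ^ (i : ℕ))
    (r s : Bool → F)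
    (h2 : ∀ i t, G₁ i (E (Sum.inr t)) =
      if (i : ℕ) = k - 2 then r t else if (i : ℕ) = k - 1 then s t else 0)
    (c : Fin (q + 1) → F) :
    (∀ y : Fin (q + 1) → F, (∃ x : Fin k → F, y = Matrix.vecMul x G₁) →
          ∑ i, c i * y i = 0) ↔ rlCode k r s (c ∘ E) := by
  have key : ∀ g : F[X], g.natDegree < k →
      ∑ j, c j * Matrix.vecMul (fun i : Fin k => g.coeff i) G₁ j =
      ∑ x : Fˣ, c (E (Sum.inl x)) * g.eval (x : F) +
        g.coeff (k - 2) * ∑ t, r t * c (E (Sum.inr t)) +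
        g.coeff (k - 1) * ∑ t, s t * c (E (Sum.inr t)) := by
    intro g hg
    have e1 : ∀ x : Fˣ, Matrix.vecMul (fun i : Fin k => g.coeff i) G₁ (E (Sum.inl x)) =
        g.eval (x : F) := by
      intro x
      rw [eval_eq_sum_range' hg, Finset.sum_range]
      simp [Matrix.vecMul, dotProduct, h1]
    have e2 : ∀ t, Matrix.vecMul (fun i : Fin k => g.coeff i) G₁ (E (Sum.inr t)) =
        g.coeff (k - 2) * r t + g.coeff (k - 1) * s t := by
      intro t
      simp only [Matrix.vecMul, dotProduct, h2]
      rw [← Finset.sum_range (fun i => g.coeff i * (if i = k - 2 then r t else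
        if i = k - 1 then s t else 0))]
      have e3 : ∀ i, g.coeff i * (if i = k - 2 then r t else if i = k - 1 then s t else 0) =
          (if i = k - 2 then g.coeff i * r t else 0) +
            (if i = k - 1 then g.coeff i * s t else 0) := by
        intro i
        by_cases h : i = k - 2
        · have : i ≠ k - 1 := by omega
          simp [h, show k - 2 ≠ k - 1 by omega]
        · simp [h]
      simp_rw [e3]
      rw [Finset.sum_add_distrib, Finset.sum_ite_eq', Finset.sum_ite_eq',
        if_pos (Finset.mem_range.2 (by omega)), if_pos (Finset.mem_range.2 (by omega))]
    rw [← E.sum_comp, Fintype.sum_sum_type]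
    simp_rw [e1, e2]
    rw [Fintype.sum_bool, Fintype.sum_bool, Fintype.sum_bool]
    ring
  constructor
  · intro h g hg
    rw [← h _ ⟨_, rfl⟩]
    exact (key g hg).symm
  · rintro h y ⟨x, rfl⟩
    have hx : x = fun i : Fin k => (ofFn k x).coeff i := by
      funext i
      simp
    have hd : (ofFn k x).natDegree < k := ofFn_natDegree_lt (by omega) x
    rw [hx, key _ hd]
    exact h _ hd

lemma rl_norm_comp {F ι κ : Type*} [Field F] [DecidableEq F] [Fintype ι] [Fintype κ] (E : ι ≃ κ)
    (c : κ → F) : hammingNorm (c ∘ E) = hammingNorm c := by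
  unfold hammingNorm
  rw [← Finset.card_map E.toEmbedding]
  congr 1
  ext j
  simp [Finset.mem_map_equiv]

/-- exactly one of a₂₁, a₂₂ vanishes (the first row nonzero): weight-k count formula. -/
theorem stmt7 (p m q k : ℕ) (hp : p.Prime) (hm : 0 < m) (hq : q = p ^ m)
    (F : Type*) [Field F] [Fintype F] [DecidableEq F] (hF : Fintype.card F = q)
    (hrange : (p = 2 ∧ 4 ≤ k ∧ k ≤ q - 3) ∨ (Odd p ∧ 3 ≤ k ∧ k ≤ q - 2))
    (β : Fin (q - 1) → F) (hβinj : Function.Injective β)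
    (hβrange : Set.range β = {x : F | x ≠ 0})
    (a : Matrix (Fin 2) (Fin 2) F) (ha : IsUnit a.det)
    (G₁ : Matrix (Fin k) (Fin (q + 1)) F)
    (hGv : ∀ (i : Fin k) (j : Fin (q + 1)) (h : (j : ℕ) < q - 1),
      G₁ i j = β ⟨j, h⟩ ^ (i : ℕ))
    (hGc1 : ∀ (i : Fin k) (j : Fin (q + 1)), (j : ℕ) = q - 1 →
      G₁ i j = if (i : ℕ) = k - 2 then a 0 0 else if (i : ℕ) = k - 1 then a 1 0 else 0)
    (hGc2 : ∀ (i : Fin k) (j : Fin (q + 1)), (j : ℕ) = q →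
      G₁ i j = if (i : ℕ) = k - 2 then a 0 1 else if (i : ℕ) = k - 1 then a 1 1 else 0)
    (hA : (a 0 0 * a 0 1 * a 1 0 ≠ 0 ∧ a 1 1 = 0) ∨ (a 0 0 * a 0 1 * a 1 1 ≠ 0 ∧ a 1 0 = 0)) :
    ((∃ c : Fin (q + 1) → F,
        (∀ y : Fin (q + 1) → F, (∃ x : Fin k → F, y = Matrix.vecMul x G₁) →
          ∑ i, c i * y i = 0) ∧ c ≠ 0 ∧ hammingNorm c = k) ∧
      (∀ c : Fin (q + 1) → F,
        (∀ y : Fin (q + 1) → F, (∃ x : Fin k → F, y = Matrix.vecMul x G₁) →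
          ∑ i, c i * y i = 0) → c ≠ 0 → k ≤ hammingNorm c)) ∧
    (({c : Fin (q + 1) → F |
        (∀ y : Fin (q + 1) → F, (∃ x : Fin k → F, y = Matrix.vecMul x G₁) →
          ∑ i, c i * y i = 0) ∧ hammingNorm c = k}.ncard : ℚ) =
      2 * ((q : ℚ) - 1) / q * ((q - 1).choose (k - 1) : ℚ) +
      (-1 : ℚ) ^ (k - 1 + (k - 1) / p) * (((q : ℚ) - 1) * ((q : ℚ) - 2) / q) *
        (((q / p - 1).choose ((k - 1) / p) : ℕ) : ℚ)) := by
  have hk3 : 3 ≤ k := by omega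
  have hkq : k + 2 ≤ q := by omega
  have hk : 2 ≤ k := by omega
  -- the index equivalence
  have hβ0 : ∀ i, β i ≠ 0 := by
    intro i
    have : β i ∈ Set.range β := ⟨i, rfl⟩
    rw [hβrange] at this
    exact this
  let φ : Fin (q - 1) ≃ Fˣ := Equiv.ofBijective (fun i => Units.mk0 (β i) (hβ0 i)) (by
    rw [Fintype.bijective_iff_injective_and_card]
    refine ⟨fun i j h => hβinj (by simpa using congrArg (fun u : Fˣ => (u : F)) h), ?_⟩
    rw [Fintype.card_units, hF, Fintype.card_fin])
  have hφ : ∀ x : Fˣ, β (φ.symm x) = x := by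
    intro x
    have : ((φ (φ.symm x) : Fˣ) : F) = x := by rw [Equiv.apply_symm_apply]
    exact this
  let E : Fˣ ⊕ Bool ≃ Fin (q + 1) := Equiv.ofBijective
    (Sum.elim (fun x => ⟨(φ.symm x : ℕ), by have := (φ.symm x).2; omega⟩)
      (fun t => if t then ⟨q, by omega⟩ else ⟨q - 1, by omega⟩)) (by
    rw [Fintype.bijective_iff_injective_and_card]
    constructor
    · rintro (x | t) (y | t') h
      · simp only [Sum.elim_inl, Fin.mk.injEq] at h
        rw [φ.symm.injective (Fin.ext h)]
      · exfalso
        have := (φ.symm x).2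
        cases t' <;> simp at h <;> omega
      · exfalso
        have := (φ.symm y).2
        cases t <;> simp at h <;> omega
      · cases t <;> cases t' <;> simp at h ⊢ <;> omega
    · rw [Fintype.card_sum, Fintype.card_units, hF, Fintype.card_bool, Fintype.card_fin]
      omega)
  let r : Bool → F := fun t => if t then a 0 1 else a 0 0
  let s : Bool → F := fun t => if t then a 1 1 else a 1 0
  have h1 : ∀ i x, G₁ i (E (Sum.inl x)) = (x : F) ^ (i : ℕ) := by
    intro i x
    have := hGv i (E (Sum.inl x)) (φ.symm x).2
    rw [this, ← hφ x]
    rfl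
  have h2 : ∀ i t, G₁ i (E (Sum.inr t)) =
      if (i : ℕ) = k - 2 then r t else if (i : ℕ) = k - 1 then s t else 0 := by
    intro i t
    cases t
    · exact hGc1 i _ rfl
    · exact hGc2 i _ rfl
  have htr := rl_transfer q k hk a G₁ E h1 r s h2
  have hr : ∀ t, r t ≠ 0 := by
    have h00 : a 0 0 ≠ 0 := by
      intro h
      simp [h] at hA
    have h01 : a 0 1 ≠ 0 := by
      intro h
      simp [h] at hA
    intro t
    cases t
    · exact h00
    · exact h01
  have hdet : r false * s true - r true * s false ≠ 0 := by
    have := ha.ne_zero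
    rw [Matrix.det_fin_two] at this
    exact this
  simp_rw [htr]
  -- the count
  have hset : {c : Fin (q + 1) → F | rlCode k r s (c ∘ E) ∧ hammingNorm c = k} =
      (fun w : Fˣ ⊕ Bool → F => w ∘ E.symm) '' (rlW r '' (rlT k r s)) := by
    rw [← rl_set k hk r s hr hdet]
    ext c
    constructor
    · rintro ⟨hc, hn⟩
      exact ⟨c ∘ E, ⟨hc, by rw [rl_norm_comp, hn]⟩, by funext; simp⟩
    · rintro ⟨w, ⟨hw, hn⟩, rfl⟩
      have : (w ∘ E.symm) ∘ E = w := by funext; simp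
      refine ⟨?_, ?_⟩
      · simp only [this]; exact hw
      · simp only [rl_norm_comp, hn]
  have hcard : {c : Fin (q + 1) → F | rlCode k r s (c ∘ E) ∧ hammingNorm c = k}.ncard =
      (q - 1) * (rlN F (k - 1) (s false / r false) + rlN F (k - 1) (s true / r true)) := by
    rw [hset, Set.ncard_image_of_injective, Set.ncard_image_of_injective _ (rl_W_inj r hr),
      Set.ncard_coe_finset, rl_T_card q k hF r s hr]
    intro w w' h
    funext z
    simpa using congrFun h (E z)
  obtain ⟨b, hb, hsum⟩ : ∃ b : F, b ≠ 0 ∧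
      rlN F (k - 1) (s false / r false) + rlN F (k - 1) (s true / r true) =
      rlN F (k - 1) 0 + rlN F (k - 1) b := by
    rcases hA with ⟨h, h0⟩ | ⟨h, h0⟩
    · refine ⟨s false / r false, div_ne_zero ?_ (hr _), ?_⟩
      · exact right_ne_zero_of_mul h
      · have : s true = 0 := h0
        rw [this, zero_div, add_comm]
    · refine ⟨s true / r true, div_ne_zero ?_ (hr _), ?_⟩
      · exact right_ne_zero_of_mul h
      · have : s false = 0 := h0
        rw [this, zero_div]
  rw [hsum] at hcard
  have hpos := rl_exists q hF (k - 1) (by omega) (by omega) b hb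
  refine ⟨⟨?_, ?_⟩, ?_⟩
  · have : 0 < {c : Fin (q + 1) → F | rlCode k r s (c ∘ E) ∧ hammingNorm c = k}.ncard := by
      rw [hcard]
      apply Nat.mul_pos <;> omega
    obtain ⟨c, hc, hn⟩ := Set.nonempty_of_ncard_ne_zero this.ne'
    refine ⟨c, hc, ?_, hn⟩
    rintro rfl
    rw [hammingNorm_zero] at hn
    omega
  · intro c hc hc0
    rw [← rl_norm_comp E c]
    refine (rl_mindist k hk r s hdet _ hc ?_).1
    intro h
    apply hc0
    funext j
    simpa using congrFun h (E.symm j)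
  · rw [hcard, ← rl_count p m q hp hm hq hF (k - 1) b hb]
    push_cast [Nat.cast_sub (show 1 ≤ q by omega)]
    ring
end

section
/- Suppose (p = 2 and 4 ≤ k ≤ q−3) or (p odd and 3 ≤ k ≤ q−2), and suppose either (a_{12}a_{21} ≠ 0 and a_{11} = a_{22} = 0) or (a_{11}a_{22} ≠ 0 and a_{12} = a_{21} = 0). Then the minimum distance of RL_k^⊥(F_q^*, M) equals k, and the number of codewords of Hamming weight exactly k in RL_k^⊥(F_q^*, M) equals ((q−1)/q)·C(q−1, k−1) + (−1)^{k−1+⌊(k−1)/p⌋}·((q−1)^2/q)·C(q/p − 1, ⌊(k−1)/p⌋), where C(·,·) denotes the binomial coefficient. -/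
section AuxRL

open Polynomial Finset

lemma aux_L {F : Type*} [Field F] (S : Finset F) (c : F → F) (f : F[X]) :
    ∑ x ∈ S, c x * f.eval x =
      ∑ i ∈ range (f.natDegree + 1), f.coeff i * ∑ x ∈ S, c x * x ^ i := by
  simp_rw [Polynomial.eval_eq_sum_range, Finset.mul_sum]
  rw [Finset.sum_comm]
  refine Finset.sum_congr rfl fun i _ => Finset.sum_congr rfl fun x _ => by ring

lemma aux_W {F : Type*} [Field F] [DecidableEq F] (S : Finset F) (c : F → F)
    (h : ∀ i, i < #S - 1 → ∑ x ∈ S, c x * x ^ i = 0) (x : F) (hx : x ∈ S) :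
    c x * ∏ y ∈ S.erase x, (x - y) = ∑ x ∈ S, c x * x ^ (#S - 1) := by
  have h1 := aux_L S c (∏ y ∈ S.erase x, (X - C y))
  have hd : (∏ y ∈ S.erase x, (X - C y)).natDegree = #S - 1 := by
    rw [Polynomial.natDegree_finsetProd_X_sub_C_eq_card, Finset.card_erase_of_mem hx]
  have hm : (∏ y ∈ S.erase x, (X - C y)).Monic := Polynomial.monic_prod_of_monic _ _ fun y _ => monic_X_sub_C y
  rw [hd, Finset.sum_range_succ, Finset.sum_eq_zero (s := range _), Finset.sum_eq_single x] at h1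
  · rw [Polynomial.eval_prod] at h1
    simp only [eval_sub, eval_X, eval_C] at h1
    rw [h1, ← hd, hm.coeff_natDegree]; simp
  · intro y hy hyx
    rw [Polynomial.eval_prod, Finset.prod_eq_zero (Finset.mem_erase.2 ⟨hyx, hy⟩) (by simp), mul_zero]
  · exact fun h => absurd hx h
  · intro i hi
    rw [h i (Finset.mem_range.1 hi), mul_zero]

lemma aux_V {F : Type*} [Field F] [DecidableEq F] (S : Finset F) (c : F → F)
    (h : ∀ i, i < #S → ∑ x ∈ S, c x * x ^ i = 0) (x : F) (hx : x ∈ S) : c x = 0 := by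
  have h0 : 0 < #S := Finset.card_pos.2 ⟨x, hx⟩
  have := aux_W S c (fun i hi => h i (by omega)) x hx
  rw [h _ (by omega)] at this
  rcases mul_eq_zero.1 this with h | h
  · exact h
  · obtain ⟨y, hy, hxy⟩ := Finset.prod_eq_zero_iff.1 h
    exact absurd (sub_eq_zero.1 hxy).symm (Finset.mem_erase.1 hy).1

lemma aux_H {F : Type*} [Field F] [DecidableEq F] (S : Finset F) (c : F → F) (h0 : 0 < #S)
    (h : ∀ i, i < #S - 1 → ∑ x ∈ S, c x * x ^ i = 0) :
    ∑ x ∈ S, c x * x ^ #S = (∑ x ∈ S, x) * ∑ x ∈ S, c x * x ^ (#S - 1) := by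
  have h1 := aux_L S c (∏ y ∈ S, (X - C y))
  have hd : (∏ y ∈ S, (X - C y)).natDegree = #S := by
    rw [Polynomial.natDegree_finsetProd_X_sub_C_eq_card]
  have hm : (∏ y ∈ S, (X - C y)).Monic := Polynomial.monic_prod_of_monic _ _ fun y _ => monic_X_sub_C y
  have hc : (∏ y ∈ S, (X - C y)).coeff (#S - 1) = - ∑ x ∈ S, x :=
    Polynomial.prod_X_sub_C_coeff_card_pred S (fun x => x) h0
  obtain ⟨n, hn⟩ : ∃ n, #S = n + 1 := ⟨#S - 1, by omega⟩
  have hcd : (∏ y ∈ S, (X - C y)).coeff (n+1) = 1 := by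
    rw [← hn, ← hd]; exact hm.coeff_natDegree
  rw [hd] at h1
  simp only [hn, Nat.add_sub_cancel] at *
  rw [Finset.sum_range_succ, Finset.sum_range_succ, hc, hcd,
    Finset.sum_eq_zero (s := range _), Finset.sum_eq_zero (s := S)] at h1
  · linear_combination -h1
  · intro y hy
    rw [Polynomial.eval_prod, Finset.prod_eq_zero hy (by simp), mul_zero]
  · intro i hi
    rw [h i (Finset.mem_range.1 hi), mul_zero]

lemma aux_E {F : Type*} [Field F] [DecidableEq F] (S : Finset F) (i : ℕ) (hi : i < #S) :
    ∑ x ∈ S, (∏ y ∈ S.erase x, (x - y))⁻¹ * x ^ i = if i = #S - 1 then 1 else 0 := by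
  have := Lagrange.coeff_eq_sum (s := S) (v := id) (Function.injective_id.injOn) (P := (X ^ i : F[X]))
    (by rw [degree_X_pow]; exact_mod_cast hi)
  rw [Polynomial.coeff_X_pow] at this
  simp only [id, eval_pow, eval_X] at this
  simp_rw [mul_comm, ← div_eq_mul_inv]
  rw [← this]; simp [eq_comm]

lemma aux_prodchar {F : Type*} [Field F] [Fintype F] [DecidableEq F] (p m : ℕ) (hp : p.Prime)
    (hF : Fintype.card F = p ^ m) (hm : 0 < m) (ψ : AddChar F ℂ) (hψ : ψ ≠ 1) (t : ℂ) :
    ∏ x : F, (1 - ψ x * t) = (1 - t ^ p) ^ (p ^ m / p) := by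
  have hchar : (p : F) = 0 := by
    have h : ((p ^ m : ℕ) : F) = 0 := by rw [← hF]; exact Nat.cast_card_eq_zero F
    rw [Nat.cast_pow] at h
    exact pow_eq_zero_iff (by omega) |>.1 h
  have hroot : ∀ x, ψ x ^ p = 1 := by
    intro x
    rw [← AddChar.map_nsmul_eq_pow, nsmul_eq_mul, hchar, zero_mul, AddChar.map_zero_eq_one]
  obtain ⟨a, ha⟩ : ∃ a, ψ a ≠ 1 := by
    by_contra! h
    exact hψ (by ext x; simp [h x])
  have hprim : IsPrimitiveRoot (ψ a) p := by
    have : Fact p.Prime := ⟨hp⟩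
    have := IsPrimitiveRoot.orderOf (ψ a)
    rwa [orderOf_eq_prime (hroot a) ha] at this
  have : NeZero p := ⟨hp.ne_zero⟩
  have hfib : ∀ ω ∈ nthRootsFinset p (1 : ℂ),
      #{x : F | ψ x = ω} = #{x : F | ψ x = 1} := by
    intro ω hω
    rw [mem_nthRootsFinset hp.pos] at hω
    obtain ⟨i, -, hi⟩ := hprim.eq_pow_of_pow_eq_one hω
    have hω0 : ω ≠ 0 := by
      rintro rfl; rw [zero_pow hp.ne_zero] at hω; exact zero_ne_one hω
    symm
    refine Finset.card_bij (fun x _ => x + i • a) ?_ ?_ ?_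
    · intro x hx
      simp only [mem_filter, mem_univ, true_and] at hx ⊢
      rw [AddChar.map_add_eq_mul, AddChar.map_nsmul_eq_pow, hx, hi, one_mul]
    · intro x _ y _ h
      exact add_right_cancel h
    · intro y hy
      simp only [mem_filter, mem_univ, true_and] at hy
      refine ⟨y - i • a, ?_, by simp⟩
      simp only [mem_filter, mem_univ, true_and]
      have : ψ (y - i • a) * ω = ω := by
        rw [← hi, ← AddChar.map_nsmul_eq_pow, ← AddChar.map_add_eq_mul, sub_add_cancel, hy, ← hi,
          AddChar.map_nsmul_eq_pow]
      exact mul_right_cancel₀ hω0 (by rw [this, one_mul])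
  have hmaps : ∀ x ∈ (univ : Finset F), ψ x ∈ nthRootsFinset p (1 : ℂ) := by
    intro x _
    rw [mem_nthRootsFinset hp.pos]; exact hroot x
  have hcard := Finset.card_eq_sum_card_fiberwise hmaps
  rw [Finset.sum_congr rfl hfib, Finset.sum_const, hprim.card_nthRootsFinset, Finset.card_univ, hF,
    smul_eq_mul] at hcard
  have hfc : #{x : F | ψ x = 1} = p ^ m / p := by
    rw [hcard, Nat.mul_div_cancel_left _ hp.pos]
  have h1 := hprim.pow_sub_pow_eq_prod_sub_mul 1 t hp.pos
  rw [one_pow] at h1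
  rw [h1, ← Finset.prod_pow, ← Finset.prod_fiberwise_of_maps_to hmaps]
  refine Finset.prod_congr rfl fun ω hω => ?_
  rw [← hfc, ← hfib ω hω, ← Finset.prod_const]
  refine Finset.prod_congr rfl fun x hx => ?_
  rw [(mem_filter.1 hx).2]

lemma aux_coeff (p Q n : ℕ) (hp : 0 < p) :
    (((1 - X ^ p : ℂ[X]) ^ Q) * ∑ i ∈ range p, X ^ i).coeff n =
      (-1) ^ (n / p) * (Q.choose (n / p) : ℂ) := by
  have h1 : (1 - X ^ p : ℂ[X]) ^ Q =
      ∑ j ∈ range (Q + 1), C ((-1) ^ j * (Q.choose j : ℂ)) * X ^ (p * j) := by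
    rw [sub_eq_add_neg, add_comm, add_pow]
    refine Finset.sum_congr rfl fun j _ => ?_
    rw [neg_pow, ← pow_mul]; simp; ring
  rw [h1, Finset.sum_mul_sum, finsetSum_coeff]
  simp_rw [finsetSum_coeff, mul_assoc, ← pow_add, coeff_C_mul, coeff_X_pow]
  have key : ∀ j, ∑ i ∈ range p, ((-1) ^ j * (Q.choose j : ℂ)) * (if n = p * j + i then (1:ℂ) else 0)
      = if j = n / p then (-1) ^ j * (Q.choose j : ℂ) else 0 := by
    intro j
    by_cases hj : j = n / p
    · rw [if_pos hj, Finset.sum_eq_single (n % p)]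
      · rw [if_pos (by rw [hj]; exact (Nat.div_add_mod n p).symm), mul_one]
      · intro i _ hi
        rw [if_neg, mul_zero]
        intro h
        have := Nat.div_add_mod n p
        rw [← hj] at this
        omega
      · intro h; exact absurd (mem_range.2 (Nat.mod_lt _ hp)) h
    · rw [if_neg hj]
      refine Finset.sum_eq_zero fun i hi => ?_
      rw [if_neg, mul_zero]
      intro h
      apply hj
      rw [h, Nat.mul_add_div hp, Nat.div_eq_of_lt (mem_range.1 hi), add_zero]
  rw [Finset.sum_congr rfl fun j _ => key j, Finset.sum_ite_eq']
  split_ifs with h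
  · rfl
  · rw [Nat.choose_eq_zero_of_lt (by simpa using h)]; simp

lemma aux_mapsum {F : Type*} [Field F] [DecidableEq F] (ψ : AddChar F ℂ) (S : Finset F) :
    ψ (∑ x ∈ S, x) = ∏ x ∈ S, ψ x := by
  induction S using Finset.induction_on with
  | empty => simp
  | insert a S ha ih => rw [sum_insert ha, prod_insert ha, AddChar.map_add_eq_mul, ih]

lemma aux_D {F : Type*} [Field F] [Fintype F] [DecidableEq F] (p m n : ℕ) (hp : p.Prime)
    (hF : Fintype.card F = p ^ m) (hm : 0 < m) (ψ : AddChar F ℂ) (hψ : ψ ≠ 1) :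
    ∑ S ∈ powersetCard n (univ.erase (0 : F)), ψ (∑ x ∈ S, x) =
      (-1) ^ (n + n / p) * ((p ^ m / p - 1).choose (n / p) : ℂ) := by
  have hQ : p ^ m / p = (p ^ m / p - 1) + 1 := by
    have : 0 < p ^ m / p := Nat.div_pos (Nat.le_of_dvd (pow_pos hp.pos _) (dvd_pow_self _ hm.ne')) hp.pos
    omega
  set Q := p ^ m / p - 1
  have hP : ∏ x ∈ univ.erase (0:F), (1 + C (-ψ x) * X) =
      ((1 - X ^ p : ℂ[X]) ^ Q) * ∑ i ∈ range p, X ^ i := by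
    have hne : (1 - X : ℂ[X]) ≠ 0 := by
      intro h
      have := congrArg (eval 0) h
      simp at this
    apply mul_left_cancel₀ hne
    have e : (1 - X : ℂ[X]) * (((1 - X ^ p : ℂ[X]) ^ Q) * ∑ i ∈ range p, X ^ i) =
        (1 - X ^ p) ^ (p ^ m / p) := by
      rw [hQ, pow_succ, ← mul_neg_geom_sum]; ring
    rw [e]
    apply Polynomial.funext
    intro t
    rw [eval_pow, eval_sub, eval_one, eval_pow, eval_X, ← aux_prodchar p m hp hF hm ψ hψ t,
      ← Finset.mul_prod_erase univ _ (mem_univ (0:F)), AddChar.map_zero_eq_one, eval_mul, eval_prod]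
    simp [sub_eq_add_neg]
  have h2 := aux_coeff p Q n hp.pos
  rw [← hP, Finset.prod_one_add, finsetSum_coeff] at h2
  rw [pow_add, mul_assoc, ← h2, Finset.mul_sum, Finset.powersetCard_eq_filter, Finset.sum_filter]
  refine Finset.sum_congr rfl fun S _ => ?_
  have : ∏ i ∈ S, (C (-ψ i) * X) = C ((-1) ^ #S * ψ (∑ x ∈ S, x)) * X ^ #S := by
    rw [Finset.prod_mul_distrib, Finset.prod_const, aux_mapsum, ← map_prod,
      Finset.prod_neg]
  rw [this, coeff_C_mul, coeff_X_pow]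
  by_cases h : #S = n
  · rw [if_pos h, if_pos h.symm, h, mul_one, ← mul_assoc, ← mul_pow]; simp
  · rw [if_neg h, if_neg (Ne.symm h)]; simp

lemma aux_N {F : Type*} [Field F] [Fintype F] [DecidableEq F] (p m q n : ℕ) (hp : p.Prime)
    (hF : Fintype.card F = q) (hq : q = p ^ m) (hm : 0 < m) :
    (#{S ∈ powersetCard n (univ.erase (0 : F)) | ∑ x ∈ S, x = 0} : ℚ) * q =
      ((q - 1).choose n : ℚ) + ((q : ℚ) - 1) * ((-1) ^ (n + n / p) *
        ((q / p - 1).choose (n / p) : ℚ)) := by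
  have hq1 : 1 ≤ q := by rw [hq]; exact Nat.one_le_pow _ _ hp.pos
  suffices h : (#{S ∈ powersetCard n (univ.erase (0 : F)) | ∑ x ∈ S, x = 0} : ℂ) * q =
      ((q - 1).choose n : ℂ) + ((q : ℂ) - 1) * ((-1) ^ (n + n / p) *
        ((q / p - 1).choose (n / p) : ℂ)) by exact_mod_cast h
  set ψ := AddChar.FiniteField.primitiveChar_to_Complex F
  have hψ : ψ.IsPrimitive := AddChar.FiniteField.primitiveChar_to_Complex_isPrimitive F
  have h1 : ∑ S ∈ powersetCard n (univ.erase (0 : F)), ∑ c : F, ψ (c * ∑ x ∈ S, x) =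
      (#{S ∈ powersetCard n (univ.erase (0 : F)) | ∑ x ∈ S, x = 0} : ℂ) * q := by
    rw [Finset.card_filter, Nat.cast_sum, Finset.sum_mul]
    refine Finset.sum_congr rfl fun S _ => ?_
    rw [AddChar.sum_mulShift _ hψ, hF]
    split_ifs <;> simp
  rw [← h1, Finset.sum_comm, ← Finset.add_sum_erase univ _ (mem_univ (0:F))]
  congr 1
  · simp [hF]
  · rw [Finset.sum_congr rfl (g := fun _ => (-1) ^ (n + n / p) *
        ((q / p - 1).choose (n / p) : ℂ)), Finset.sum_const, Finset.card_erase_of_mem (mem_univ _),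
        Finset.card_univ, hF, nsmul_eq_mul, Nat.cast_sub hq1, Nat.cast_one]
    intro c hc
    have := aux_D p m n hp (hF.trans hq) hm (AddChar.mulShift ψ c) (hψ (mem_erase.1 hc).1)
    simp only [AddChar.mulShift_apply] at this
    rw [this, hq]

lemma aux_ex1 {F : Type*} [Field F] [Fintype F] [DecidableEq F] (n : ℕ) (hn : 2 ≤ n)
    (h2n : 2 * n ≤ Fintype.card F) (h2 : (2 : F) = 0 → 3 ≤ n) :
    ∃ S ∈ powersetCard n (univ.erase (0 : F)), ∑ x ∈ S, x = 0 := by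
  obtain ⟨U, hU0, hUc, hUs⟩ : ∃ U : Finset F, 0 ∉ U ∧ #U = n - 2 ∧ ((2 : F) = 0 → ∑ x ∈ U, x ≠ 0) := by
    by_cases h : n = 2
    · exact ⟨∅, by simp, by simp [h], fun h' => absurd (h2 h') (by omega)⟩
    · obtain ⟨W, hW, hWc⟩ := Finset.exists_subset_card_eq (s := univ.erase (0:F)) (n := n - 3)
        (by rw [Finset.card_erase_of_mem (mem_univ _), card_univ]; omega)
      have : ∃ y, y ∉ insert (-∑ x ∈ W, x) (insert 0 W) := by
        by_contra! hh
        have h3 : #(insert (-∑ x ∈ W, x) (insert 0 W)) = Fintype.card F := by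
          rw [Finset.eq_univ_of_forall hh, card_univ]
        have h4 := Finset.card_insert_le (-∑ x ∈ W, x) (insert 0 W)
        have h5 := Finset.card_insert_le 0 W
        omega
      obtain ⟨y, hy⟩ := this
      simp only [mem_insert, not_or] at hy
      refine ⟨insert y W, ?_, ?_, ?_⟩
      · rw [mem_insert, not_or]
        exact ⟨fun h => hy.2.1 h.symm, fun h => by simpa using hW h⟩
      · rw [card_insert_of_notMem hy.2.2]; omega
      · intro _ hs
        rw [sum_insert hy.2.2] at hs
        exact hy.1 (eq_neg_of_add_eq_zero_left hs)
  set σ := ∑ x ∈ U, x with hσ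
  have : ∃ y, y ∉ insert (-σ / 2) ((insert 0 U) ∪ (insert 0 U).image (fun z => -σ - z)) := by
    by_contra! hh
    have h3 := congrArg card (Finset.eq_univ_of_forall hh)
    rw [card_univ] at h3
    have h4 := Finset.card_insert_le (-σ/2) ((insert 0 U) ∪ (insert 0 U).image (fun z => -σ - z))
    have h5 := Finset.card_union_le (insert 0 U) ((insert 0 U).image (fun z => -σ - z))
    have h6 := Finset.card_insert_le 0 U
    have h7 := Finset.card_image_le (s := insert 0 U) (f := fun z => -σ - z)
    omega
  obtain ⟨y, hy⟩ := this
  rw [mem_insert, mem_union, mem_image] at hy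
  push Not at hy
  obtain ⟨hy1, hy2, hy3⟩ := hy
  have hz : -σ - y ∉ insert 0 U := fun h => hy3 _ h (by ring)
  rw [mem_insert, not_or] at hy2 hz
  have hne : y ≠ -σ - y := by
    intro h
    by_cases h2' : (2 : F) = 0
    · apply hUs h2'
      linear_combination h - y * h2'
    · apply hy1
      field_simp
      linear_combination h
  have hn1 : y ∉ insert (-σ - y) U := by
    rw [mem_insert, not_or]; exact ⟨hne, hy2.2⟩
  refine ⟨insert y (insert (-σ - y) U), ?_, ?_⟩
  · rw [mem_powersetCard]
    constructor
    · intro x hx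
      rw [mem_erase]
      refine ⟨?_, mem_univ _⟩
      rintro rfl
      simp only [mem_insert] at hx
      rcases hx with h | h | h
      · exact hy2.1 h.symm
      · exact hz.1 h.symm
      · exact hU0 h
    · rw [card_insert_of_notMem hn1, card_insert_of_notMem hz.2]; omega
  · rw [sum_insert hn1, sum_insert hz.2, ← hσ]; ring

lemma aux_ex {F : Type*} [Field F] [Fintype F] [DecidableEq F] (n : ℕ) (hn : 2 ≤ n)
    (hnq : n + 3 ≤ Fintype.card F) (h2 : (2 : F) = 0 → 3 ≤ n ∧ n + 4 ≤ Fintype.card F) :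
    ∃ S ∈ powersetCard n (univ.erase (0 : F)), ∑ x ∈ S, x = 0 := by
  by_cases h : 2 * n ≤ Fintype.card F
  · exact aux_ex1 n hn h fun h => (h2 h).1
  · obtain ⟨S, hS, hs⟩ := aux_ex1 (F := F) (Fintype.card F - 1 - n) (by omega) (by omega)
      (fun h => by have := (h2 h).2; omega)
    rw [mem_powersetCard] at hS
    refine ⟨univ.erase 0 \ S, mem_powersetCard.2 ⟨sdiff_subset, ?_⟩, ?_⟩
    · rw [card_sdiff_of_subset hS.1, Finset.card_erase_of_mem (mem_univ _), card_univ]; omega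
    · have h1 := FiniteField.sum_pow_lt_card_sub_one F 1 (by omega)
      simp only [pow_one] at h1
      rw [← Finset.add_sum_erase univ _ (mem_univ (0:F)), zero_add, ← Finset.sum_sdiff hS.1, hs,
        add_zero] at h1
      exact h1

/-- Membership in the dual code, in coordinates indexed by `Option F`. -/
def auxCode {F : Type*} [Field F] [Fintype F] [DecidableEq F] (n : ℕ) (s t : F)
    (d : Option F → F) : Prop :=
  ∀ i, i < n + 1 → ∑ x ∈ univ.erase (0 : F), d (some x) * x ^ i +
    (if i = n - 1 then s * d (some 0) else 0) + (if i = n then t * d none else 0) = 0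

/-- The support on the nonzero elements. -/
def auxSupp {F : Type*} [Field F] [Fintype F] [DecidableEq F] (d : Option F → F) : Finset F :=
  {x ∈ univ.erase (0 : F) | d (some x) ≠ 0}

lemma aux_norm {F : Type*} [Field F] [Fintype F] [DecidableEq F] (d : Option F → F) :
    hammingNorm d = #(auxSupp d) + (if d (some 0) ≠ 0 then 1 else 0) +
      (if d none ≠ 0 then 1 else 0) := by
  unfold hammingNorm auxSupp
  rw [Finset.card_filter, Fintype.sum_option, ← Finset.add_sum_erase univ _ (mem_univ (0:F)),
    Finset.card_filter]
  ring

lemma aux_sum {F : Type*} [Field F] [Fintype F] [DecidableEq F] (d : Option F → F) (i : ℕ) :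
    ∑ x ∈ univ.erase (0 : F), d (some x) * x ^ i =
      ∑ x ∈ auxSupp d, d (some x) * x ^ i := by
  unfold auxSupp
  rw [Finset.sum_filter]
  refine Finset.sum_congr rfl fun x _ => ?_
  by_cases h : d (some x) = 0 <;> simp [h]

lemma aux_supp_zero {F : Type*} [Field F] [Fintype F] [DecidableEq F] (d : Option F → F)
    (h : ∀ i, i < #(auxSupp d) → ∑ x ∈ univ.erase (0 : F), d (some x) * x ^ i = 0) :
    auxSupp d = ∅ := by
  by_contra hne
  obtain ⟨x, hx⟩ := Finset.nonempty_iff_ne_empty.2 hne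
  have := aux_V (auxSupp d) (fun x => d (some x)) (fun i hi => by rw [← aux_sum]; exact h i hi) x hx
  exact (mem_filter.1 hx).2 this

lemma aux_supp_card {F : Type*} [Field F] [Fintype F] [DecidableEq F] (n : ℕ) (hn : 2 ≤ n) (s t : F)
    (hs : s ≠ 0) (ht : t ≠ 0)
    (d : Option F → F) (hd : auxCode n s t d) (h0 : d ≠ 0) :
    n ≤ #(auxSupp d) ∧ (#(auxSupp d) = n → d (some 0) ≠ 0) ∧
      (#(auxSupp d) = n + 1 → ¬ (d (some 0) = 0 ∧ d none = 0)) := by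
  have hne : auxSupp d ≠ ∅ := by
    intro h
    apply h0
    have hz : ∀ i, ∑ x ∈ univ.erase (0 : F), d (some x) * x ^ i = 0 := by
      intro i; rw [aux_sum, h, Finset.sum_empty]
    have h1 := hd (n - 1) (by omega)
    have h2 := hd n (by omega)
    rw [hz, if_pos rfl, if_neg (by omega)] at h1
    rw [hz, if_neg (by omega), if_pos rfl] at h2
    ext j
    rcases j with _ | x
    · simpa [ht] using h2
    · by_cases hx : x = 0
      · subst hx; simpa [hs] using h1
      · by_contra hh
        have : x ∈ auxSupp d := mem_filter.2 ⟨mem_erase.2 ⟨hx, mem_univ _⟩, hh⟩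
        rw [h] at this; simp at this
  refine ⟨?_, ?_, ?_⟩
  · by_contra hlt
    refine hne (aux_supp_zero d fun i hi => ?_)
    have := hd i (by omega)
    rwa [if_neg (by omega), if_neg (by omega), add_zero, add_zero] at this
  · intro hc h00
    refine hne (aux_supp_zero d fun i hi => ?_)
    have := hd i (by omega)
    rwa [h00, mul_zero, ite_self, if_neg (by omega), add_zero, add_zero] at this
  · rintro hc ⟨h00, h01⟩
    refine hne (aux_supp_zero d fun i hi => ?_)
    have := hd i (by omega)
    rwa [h00, h01, mul_zero, mul_zero, ite_self, ite_self, add_zero, add_zero] at this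

lemma aux_min {F : Type*} [Field F] [Fintype F] [DecidableEq F] (n : ℕ) (hn : 2 ≤ n) (s t : F)
    (hs : s ≠ 0) (ht : t ≠ 0)
    (d : Option F → F) (hd : auxCode n s t d) (h0 : d ≠ 0) : n + 1 ≤ hammingNorm d := by
  obtain ⟨h1, h2, -⟩ := aux_supp_card n hn s t hs ht d hd h0
  rw [aux_norm]
  rcases h1.eq_or_lt with h | h
  · rw [if_pos (h2 h.symm)]; omega
  · omega

/-- The codeword of weight `n + 1` attached to a support and a scalar. -/
noncomputable def auxPhi {F : Type*} [Field F] [DecidableEq F] (s : F)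
    (z : Finset F × F) : Option F → F
  | none => 0
  | some x => if x = 0 then -z.2 / s else
      if x ∈ z.1 then z.2 * (∏ y ∈ z.1.erase x, (x - y))⁻¹ else 0

lemma aux_prod_ne {F : Type*} [Field F] [DecidableEq F] (S : Finset F) (x : F) :
    ∏ y ∈ S.erase x, (x - y) ≠ 0 := by
  rw [Finset.prod_ne_zero_iff]
  intro y hy
  exact sub_ne_zero.2 (mem_erase.1 hy).1.symm

lemma aux_phi_supp {F : Type*} [Field F] [Fintype F] [DecidableEq F] (s : F)
    (S : Finset F) (h0 : 0 ∉ S) (μ : F) (hμ : μ ≠ 0) : auxSupp (auxPhi s (S, μ)) = S := by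
  ext x
  simp only [auxSupp, mem_filter, mem_erase, mem_univ, and_true, auxPhi]
  constructor
  · rintro ⟨h1, h2⟩
    rw [if_neg h1] at h2
    by_contra h
    rw [if_neg h] at h2
    exact h2 rfl
  · intro hx
    have h1 : x ≠ 0 := by rintro rfl; exact h0 hx
    refine ⟨h1, ?_⟩
    rw [if_neg h1, if_pos hx]
    exact mul_ne_zero hμ (inv_ne_zero (aux_prod_ne S x))

lemma aux_count {F : Type*} [Field F] [Fintype F] [DecidableEq F] (n : ℕ) (hn : 2 ≤ n) (s t : F)
    (hs : s ≠ 0) (ht : t ≠ 0) :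
    {d : Option F → F | auxCode n s t d ∧ hammingNorm d = n + 1}.ncard =
      #{S ∈ powersetCard n (univ.erase (0 : F)) | ∑ x ∈ S, x = 0} * (Fintype.card F - 1) := by
  set Z : Finset (Finset F) := {S ∈ powersetCard n (univ.erase (0 : F)) | ∑ x ∈ S, x = 0} with hZ
  have hZm : ∀ S, S ∈ Z ↔ (0 ∉ S ∧ #S = n) ∧ ∑ x ∈ S, x = 0 := by
    intro S
    rw [hZ, mem_filter, mem_powersetCard]
    have : S ⊆ univ.erase 0 ↔ 0 ∉ S := by
      constructor
      · intro h h'; simpa using h h'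
      · intro h x hx
        exact mem_erase.2 ⟨fun h' => h (h' ▸ hx), mem_univ _⟩
    rw [this]
  have himg : {d : Option F → F | auxCode n s t d ∧ hammingNorm d = n + 1} =
      auxPhi s '' ((Z ×ˢ (univ.erase (0 : F)) : Finset _) : Set (Finset F × F)) := by
    ext d
    simp only [Set.mem_setOf_eq, Set.mem_image, mem_coe, mem_product, Prod.exists, mem_erase,
      mem_univ, and_true]
    constructor
    · rintro ⟨hd, hw⟩
      have h0 : d ≠ 0 := by
        rintro rfl
        simp at hw
      obtain ⟨h1, h2, h3⟩ := aux_supp_card n hn s t hs ht d hd h0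
      rw [aux_norm] at hw
      have hc : #(auxSupp d) = n := by
        by_contra hne
        have hc : #(auxSupp d) = n + 1 := by omega
        apply h3 hc
        constructor
        · by_contra h; rw [if_pos h] at hw; omega
        · by_contra h; rw [if_pos h] at hw; omega
      have hu := h2 hc
      have hv : d none = 0 := by
        by_contra h; rw [if_pos hu, if_pos h] at hw; omega
      have hlow : ∀ i, i < #(auxSupp d) - 1 → ∑ x ∈ auxSupp d, d (some x) * x ^ i = 0 := by
        intro i hi
        have := hd i (by omega)
        rwa [if_neg (by omega), if_neg (by omega), add_zero, add_zero, aux_sum] at this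
      have hM : ∑ x ∈ auxSupp d, d (some x) * x ^ (n - 1) = - (s * d (some 0)) := by
        have := hd (n - 1) (by omega)
        rw [if_pos rfl, if_neg (by omega), add_zero, aux_sum] at this
        exact eq_neg_of_add_eq_zero_left this
      have hMn : ∑ x ∈ auxSupp d, d (some x) * x ^ n = 0 := by
        have := hd n (by omega)
        rwa [if_neg (by omega), if_pos rfl, hv, mul_zero, add_zero, add_zero, aux_sum] at this
      have hH := aux_H (auxSupp d) (fun x => d (some x)) (by omega) hlow
      simp only [hc, hMn, hM] at hH
      have hsum : ∑ x ∈ auxSupp d, x = 0 := by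
        rcases mul_eq_zero.1 hH.symm with h | h
        · exact h
        · exact absurd h (neg_ne_zero.2 (mul_ne_zero hs hu))
      refine ⟨auxSupp d, -(s * d (some 0)), ⟨(hZm _).2 ⟨⟨by simp [auxSupp], hc⟩, hsum⟩,
        neg_ne_zero.2 (mul_ne_zero hs hu)⟩, ?_⟩
      ext j
      rcases j with _ | x
      · simp [auxPhi, hv]
      · simp only [auxPhi]
        split_ifs with hx hx'
        · subst hx; field_simp; try ring
        · have := aux_W (auxSupp d) (fun x => d (some x)) hlow x hx'
          simp only [hc, hM] at this
          rw [← this, mul_assoc, mul_inv_cancel₀ (aux_prod_ne _ _), mul_one]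
        · by_contra hh
          exact hx' (mem_filter.2 ⟨mem_erase.2 ⟨hx, mem_univ _⟩, fun h => hh h.symm⟩)
    · rintro ⟨S, μ, ⟨hS, hμ⟩, rfl⟩
      obtain ⟨⟨hS0, hSc⟩, hSs⟩ := (hZm S).1 hS
      have hsupp := aux_phi_supp s S hS0 μ hμ
      have hval : ∀ i, ∑ x ∈ S, auxPhi s (S, μ) (some x) * x ^ i =
          μ * ∑ x ∈ S, (∏ y ∈ S.erase x, (x - y))⁻¹ * x ^ i := by
        intro i
        rw [Finset.mul_sum]
        refine Finset.sum_congr rfl fun x hx => ?_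
        have h1 : x ≠ 0 := by rintro rfl; exact hS0 hx
        simp only [auxPhi]
        rw [if_neg h1, if_pos hx, mul_assoc]
      constructor
      · intro i hi
        rw [aux_sum, hsupp, hval]
        by_cases hin : i = n
        · subst hin
          have hH := aux_H S (fun x => (∏ y ∈ S.erase x, (x - y))⁻¹) (by omega) (by
            intro j hj
            rw [aux_E S j (by omega), if_neg (by omega)])
          rw [hSs, zero_mul, hSc] at hH
          rw [hH, if_neg (by omega), if_pos rfl]
          simp [auxPhi]
        · rw [aux_E S i (by omega), if_neg hin, hSc]
          split_ifs with h
          · simp only [auxPhi, if_true]; field_simp; ring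
          · ring
      · rw [aux_norm, hsupp, hSc, if_pos, if_neg]
        · simp [auxPhi]
        · simp [auxPhi, hs, hμ]
  rw [himg, Set.ncard_image_of_injOn, Set.ncard_coe_finset, card_product,
    card_erase_of_mem (mem_univ _), card_univ]
  rintro ⟨S, μ⟩ h ⟨S', μ'⟩ h' heq
  simp only [mem_coe, mem_product, mem_erase, mem_univ, and_true] at h h'
  have e1 := aux_phi_supp s S ((hZm S).1 h.1).1.1 μ h.2
  have e2 := aux_phi_supp s S' ((hZm S').1 h'.1).1.1 μ' h'.2
  have e3 : S = S' := by rw [← e1, ← e2, heq]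
  have e4 := congrFun heq (some 0)
  simp only [auxPhi, if_true] at e4
  have e5 : μ = μ' := by
    field_simp at e4
    exact neg_injective e4
  rw [e3, e5]

lemma aux_main (q n : ℕ) (hn : 2 ≤ n) (hq2 : 2 ≤ q)
    (F : Type*) [Field F] [Fintype F] [DecidableEq F] (hF : Fintype.card F = q)
    (β : Fin (q - 1) → F) (hβinj : Function.Injective β)
    (hβrange : Set.range β = {x : F | x ≠ 0})
    (G₁ : Matrix (Fin (n + 1)) (Fin (q + 1)) F)
    (hGv : ∀ (i : Fin (n + 1)) (j : Fin (q + 1)) (h : (j : ℕ) < q - 1),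
      G₁ i j = β ⟨j, h⟩ ^ (i : ℕ))
    (ju jv : Fin (q + 1)) (hju : q - 1 ≤ (ju : ℕ)) (hjv : q - 1 ≤ (jv : ℕ)) (hne : ju ≠ jv)
    (s t : F)
    (hGu : ∀ i, G₁ i ju = if (i : ℕ) = n - 1 then s else 0)
    (hGw : ∀ i, G₁ i jv = if (i : ℕ) = n then t else 0) :
    ∃ e : Option F ≃ Fin (q + 1), ∀ c : Fin (q + 1) → F,
      (∀ y : Fin (q + 1) → F, (∃ x : Fin (n + 1) → F, y = Matrix.vecMul x G₁) →
          ∑ i, c i * y i = 0) ↔ auxCode n s t (c ∘ e) := by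
  have hex : ∀ x : F, ∃ j : Fin (q - 1), x ≠ 0 → β j = x := by
    intro x
    by_cases hx : x = 0
    · exact ⟨⟨0, by omega⟩, fun h => absurd hx h⟩
    · have : x ∈ Set.range β := by rw [hβrange]; exact hx
      obtain ⟨j, hj⟩ := this
      exact ⟨j, fun _ => hj⟩
  choose b hb using hex
  let f : Option F → Fin (q + 1) := fun o =>
    match o with
    | none => jv
    | some x => if x = 0 then ju else ⟨(b x : ℕ), by have := (b x).2; omega⟩
  have hf0 : f none = jv := rfl
  have hf1 : f (some 0) = ju := by simp [f]
  have hf2 : ∀ x, x ≠ 0 → f (some x) = ⟨(b x : ℕ), by have := (b x).2; omega⟩ := by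
    intro x hx; simp [f, hx]
  have hf3 : ∀ x, x ≠ 0 → (f (some x) : ℕ) < q - 1 := by
    intro x hx; rw [hf2 x hx]; exact (b x).2
  have hinj : Function.Injective f := by
    intro o o' h
    rcases o with _ | x <;> rcases o' with _ | x'
    · rfl
    · exfalso
      by_cases hx : x' = 0
      · subst hx; rw [hf0, hf1] at h; exact hne h.symm
      · have := hf3 x' hx; rw [← h, hf0] at this; omega
    · exfalso
      by_cases hx : x = 0
      · subst hx; rw [hf0, hf1] at h; exact hne h
      · have := hf3 x hx; rw [h, hf0] at this; omega
    · by_cases hx : x = 0 <;> by_cases hx' : x' = 0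
      · rw [hx, hx']
      · exfalso
        subst hx; have := hf3 x' hx'; rw [← h, hf1] at this; omega
      · exfalso
        subst hx'; have := hf3 x hx; rw [h, hf1] at this; omega
      · rw [hf2 x hx, hf2 x' hx', Fin.mk.injEq] at h
        rw [← hb x hx, ← hb x' hx', Fin.ext h]
  have hbij : Function.Bijective f := by
    rw [Fintype.bijective_iff_injective_and_card]
    exact ⟨hinj, by simp [hF]⟩
  refine ⟨Equiv.ofBijective f hbij, fun c => ?_⟩
  have hrow : ∀ i : Fin (n + 1), ∑ j, c j * G₁ i j =
      ∑ x ∈ univ.erase (0 : F), c (f (some x)) * x ^ (i : ℕ) +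
    (if (i : ℕ) = n - 1 then s * c (f (some 0)) else 0) +
    (if (i : ℕ) = n then t * c (f none) else 0) := by
    intro i
    rw [← (Equiv.ofBijective f hbij).sum_comp, Fintype.sum_option,
      ← Finset.add_sum_erase univ _ (mem_univ (0:F))]
    simp only [Equiv.ofBijective_apply]
    have : ∑ x ∈ univ.erase (0 : F), c (f (some x)) * G₁ i (f (some x)) =
        ∑ x ∈ univ.erase (0 : F), c (f (some x)) * x ^ (i : ℕ) := by
      refine Finset.sum_congr rfl fun x hx => ?_
      have hx0 := (mem_erase.1 hx).1
      rw [hGv i (f (some x)) (hf3 x hx0)]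
      congr 2
      refine Eq.trans (congrArg β (Fin.ext ?_)) (hb x hx0)
      simp [hf2 x hx0]
    rw [this, hf0, hf1, hGu, hGw]
    split_ifs <;> ring
  have hdual : (∀ y : Fin (q + 1) → F, (∃ x : Fin (n + 1) → F, y = Matrix.vecMul x G₁) →
          ∑ i, c i * y i = 0) ↔ ∀ i, ∑ j, c j * G₁ i j = 0 := by
    constructor
    · intro h i
      refine h (G₁ i) ⟨Pi.single i 1, ?_⟩
      rw [Matrix.single_one_vecMul]; rfl
    · rintro h y ⟨x, rfl⟩
      simp only [Matrix.vecMul, dotProduct, Finset.mul_sum]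
      rw [Finset.sum_comm]
      refine Finset.sum_eq_zero fun i _ => ?_
      have := congrArg (x i * ·) (h i)
      simp only [Finset.mul_sum, mul_zero] at this
      rw [← this]
      refine Finset.sum_congr rfl fun j _ => by ring
  rw [hdual]
  constructor
  · intro h i hi
    exact (hrow ⟨i, hi⟩).symm.trans (h ⟨i, hi⟩)
  · intro h i
    rw [hrow i]
    exact h i i.2

lemma aux_hnorm {ι κ F : Type*} [Fintype ι] [Fintype κ] [Field F] [DecidableEq F]
    (e : ι ≃ κ) (c : κ → F) : hammingNorm (c ∘ e) = hammingNorm c := by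
  unfold hammingNorm
  rw [Finset.card_filter, Finset.card_filter, ← e.sum_comp]
  rfl

end AuxRL

open Finset in
/-- M antidiagonal or diagonal: weight-k count formula. -/
theorem stmt9 (p m q k : ℕ) (hp : p.Prime) (hm : 0 < m) (hq : q = p ^ m)
    (F : Type*) [Field F] [Fintype F] [DecidableEq F] (hF : Fintype.card F = q)
    (hrange : (p = 2 ∧ 4 ≤ k ∧ k ≤ q - 3) ∨ (Odd p ∧ 3 ≤ k ∧ k ≤ q - 2))
    (β : Fin (q - 1) → F) (hβinj : Function.Injective β)
    (hβrange : Set.range β = {x : F | x ≠ 0})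
    (a : Matrix (Fin 2) (Fin 2) F) (ha : IsUnit a.det)
    (G₁ : Matrix (Fin k) (Fin (q + 1)) F)
    (hGv : ∀ (i : Fin k) (j : Fin (q + 1)) (h : (j : ℕ) < q - 1),
      G₁ i j = β ⟨j, h⟩ ^ (i : ℕ))
    (hGc1 : ∀ (i : Fin k) (j : Fin (q + 1)), (j : ℕ) = q - 1 →
      G₁ i j = if (i : ℕ) = k - 2 then a 0 0 else if (i : ℕ) = k - 1 then a 1 0 else 0)
    (hGc2 : ∀ (i : Fin k) (j : Fin (q + 1)), (j : ℕ) = q →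
      G₁ i j = if (i : ℕ) = k - 2 then a 0 1 else if (i : ℕ) = k - 1 then a 1 1 else 0)
    (hA : (a 0 1 * a 1 0 ≠ 0 ∧ a 0 0 = 0 ∧ a 1 1 = 0) ∨ (a 0 0 * a 1 1 ≠ 0 ∧ a 0 1 = 0 ∧ a 1 0 = 0)) :
    ((∃ c : Fin (q + 1) → F,
        (∀ y : Fin (q + 1) → F, (∃ x : Fin k → F, y = Matrix.vecMul x G₁) →
          ∑ i, c i * y i = 0) ∧ c ≠ 0 ∧ hammingNorm c = k) ∧
      (∀ c : Fin (q + 1) → F,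
        (∀ y : Fin (q + 1) → F, (∃ x : Fin k → F, y = Matrix.vecMul x G₁) →
          ∑ i, c i * y i = 0) → c ≠ 0 → k ≤ hammingNorm c)) ∧
    (({c : Fin (q + 1) → F |
        (∀ y : Fin (q + 1) → F, (∃ x : Fin k → F, y = Matrix.vecMul x G₁) →
          ∑ i, c i * y i = 0) ∧ hammingNorm c = k}.ncard : ℚ) =
      ((q : ℚ) - 1) / q * ((q - 1).choose (k - 1) : ℚ) +
      (-1 : ℚ) ^ (k - 1 + (k - 1) / p) * (((q : ℚ) - 1) ^ 2 / q) *
        (((q / p - 1).choose ((k - 1) / p) : ℕ) : ℚ)) := by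
  have hq2 : 5 ≤ q ∧ 3 ≤ k := by omega
  obtain ⟨n, rfl⟩ : ∃ n, k = n + 1 := ⟨k - 1, by omega⟩
  have hn : 2 ≤ n := by omega
  obtain ⟨ju, jv, s, t, hju, hjv, hne, hs, ht, hGu, hGw⟩ : ∃ (ju jv : Fin (q + 1)) (s t : F),
      q - 1 ≤ (ju : ℕ) ∧ q - 1 ≤ (jv : ℕ) ∧ ju ≠ jv ∧ s ≠ 0 ∧ t ≠ 0 ∧
      (∀ i, G₁ i ju = if (i : ℕ) = n - 1 then s else 0) ∧
      (∀ i, G₁ i jv = if (i : ℕ) = n then t else 0) := by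
    have e1 : n + 1 - 2 = n - 1 := by omega
    have e2 : n + 1 - 1 = n := by omega
    rw [e1, e2] at hGc1 hGc2
    rcases hA with ⟨h1, h2, h3⟩ | ⟨h1, h2, h3⟩
    · refine ⟨⟨q, by omega⟩, ⟨q - 1, by omega⟩, a 0 1, a 1 0, by simp, by simp, ?_,
        left_ne_zero_of_mul h1, right_ne_zero_of_mul h1, ?_, ?_⟩
      · rw [Ne, Fin.mk.injEq]; omega
      · intro i; rw [hGc2 i _ rfl, h3]; simp
      · intro i; rw [hGc1 i _ rfl, h2]
        by_cases hi : (i : ℕ) = n - 1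
        · rw [if_pos hi, if_neg (by omega)]
        · rw [if_neg hi]
    · refine ⟨⟨q - 1, by omega⟩, ⟨q, by omega⟩, a 0 0, a 1 1, by simp, by simp, ?_,
        left_ne_zero_of_mul h1, right_ne_zero_of_mul h1, ?_, ?_⟩
      · rw [Ne, Fin.mk.injEq]; omega
      · intro i; rw [hGc1 i _ rfl, h3]; simp
      · intro i; rw [hGc2 i _ rfl, h2]
        by_cases hi : (i : ℕ) = n - 1
        · rw [if_pos hi, if_neg (by omega)]
        · rw [if_neg hi]
  obtain ⟨e, he⟩ := aux_main q n hn (by omega) F hF β hβinj hβrange G₁ hGv ju jv hju hjv hne s t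
    hGu hGw
  simp_rw [he]
  have hcard : {c : Fin (q + 1) → F | auxCode n s t (c ∘ e) ∧ hammingNorm c = n + 1}.ncard =
      #{S ∈ powersetCard n (univ.erase (0 : F)) | ∑ x ∈ S, x = 0} * (q - 1) := by
    have hcnt := aux_count n hn s t hs ht
    rw [hF] at hcnt
    rw [← hcnt]
    refine Set.ncard_congr (fun c _ => c ∘ e) ?_ ?_ ?_
    · rintro c ⟨h1, h2⟩
      exact ⟨h1, by rw [aux_hnorm, h2]⟩
    · intro c c' _ _ h
      exact e.surjective.injective_comp_right h
    · rintro d ⟨h1, h2⟩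
      have hd : (d ∘ e.symm) ∘ e = d := by ext x; simp
      refine ⟨d ∘ e.symm, ⟨?_, ?_⟩, hd⟩
      · rw [hd]; exact h1
      · rw [aux_hnorm]; exact h2
  have hex : ∃ S ∈ powersetCard n (univ.erase (0 : F)), ∑ x ∈ S, x = 0 := by
    apply aux_ex n hn
    · rw [hF]; omega
    · intro h2
      have hp2 : p = 2 := by
        have hc : ((p ^ m : ℕ) : F) = 0 := by rw [← hq, ← hF]; exact Nat.cast_card_eq_zero F
        rw [Nat.cast_pow] at hc
        have hc' : (p : F) = 0 := pow_eq_zero_iff (by omega) |>.1 hc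
        rcases hp.eq_two_or_odd' with h | ⟨r, hr⟩
        · exact h
        · exfalso
          rw [hr] at hc'
          push_cast at hc'
          rw [h2, zero_mul, zero_add] at hc'
          exact one_ne_zero hc'
      have : ¬ Odd p := by rw [hp2]; decide
      rw [hF]
      rcases hrange with h | h
      · omega
      · exact absurd h.1 this
  refine ⟨⟨?_, ?_⟩, ?_⟩
  · have hpos : 0 < {c : Fin (q + 1) → F |
        auxCode n s t (c ∘ e) ∧ hammingNorm c = n + 1}.ncard := by
      rw [hcard]
      obtain ⟨S, hS, hS0⟩ := hex
      exact Nat.mul_pos (Finset.card_pos.2 ⟨S, mem_filter.2 ⟨hS, hS0⟩⟩) (by omega)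
    obtain ⟨c, hc1, hc2⟩ := Set.nonempty_of_ncard_ne_zero hpos.ne'
    refine ⟨c, hc1, ?_, hc2⟩
    rintro rfl
    simp at hc2
  · intro c hc hc0
    rw [← aux_hnorm e]
    refine aux_min n hn s t hs ht _ hc ?_
    intro h
    apply hc0
    apply e.surjective.injective_comp_right
    exact h
  · rw [hcard]
    have hN := aux_N (F := F) p m q n hp hF hq hm
    have hq0 : (q : ℚ) ≠ 0 := by
      have : q ≠ 0 := by omega
      exact_mod_cast this
    rw [← eq_div_iff hq0] at hN
    rw [Nat.cast_mul, hN, Nat.cast_sub (by omega), Nat.cast_one, Nat.add_sub_cancel]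
    field_simp
end
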